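/- arXiv:2512.15077 — 3 statements merged into one kernel-verified Lean document; each statement's English description precedes it below -/
import Mathlib

section
/- There exists an absolute constant C > 0 such that for every n ≥ 1 and every n × n real matrix A all of whose entries have absolute value at most 1, there exists a vector x ∈ {-1, 1}^n with ‖Ax‖_∞ ≤ C √n. -/
/-- The real sign `1` or `-1` encoded by a Boolean. -/
def boolSign (b : Bool) : ℝ := if b then 1 else -1

lemma sum_exp_boolSign_le {ι : Type*} [Fintype ι] [DecidableEq ι] (a : ι → ℝ) :
    ∑ x : ι → Bool, Real.exp (∑ i, a i * boolSign (x i)) ≤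
      2 ^ Fintype.card ι * Real.exp (∑ i, a i ^ 2 / 2) := by
  have h : ∑ x : ι → Bool, Real.exp (∑ i, a i * boolSign (x i)) =
      ∏ i, ∑ b : Bool, Real.exp (a i * boolSign b) := by
    rw [Finset.prod_univ_sum, Fintype.piFinset_univ]
    simp only [Real.exp_sum]
  rw [h, Real.exp_sum, ← Finset.card_univ, ← Finset.prod_const, ← Finset.prod_mul_distrib]
  refine Finset.prod_le_prod (fun i _ => by positivity) fun i _ => ?_
  have := Real.cosh_le_exp_half_sq (a i)
  rw [Real.cosh_eq] at this
  simp only [Fintype.sum_bool, boolSign]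
  simp only [if_true, Bool.false_eq_true, if_false, mul_one, mul_neg]
  linarith

lemma pow_eight_le_exp (y : ℝ) : y ^ 8 ≤ 40320 * (Real.exp y + Real.exp (-y)) := by
  have h := Real.pow_div_factorial_le_exp |y| (abs_nonneg y) 8
  rw [Even.pow_abs (by decide)] at h
  have h2 : Real.exp |y| ≤ Real.exp y + Real.exp (-y) := by
    rcases abs_cases y with ⟨h, _⟩ | ⟨h, _⟩ <;> rw [h] <;>
      linarith [Real.exp_pos y, Real.exp_pos (-y)]
  norm_num [Nat.factorial] at h
  linarith

/-- The eighth moment of a Rademacher sum with coefficients of size at most `1`. -/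
lemma sum_pow_eight_boolSign_le {ι : Type*} [Fintype ι] [DecidableEq ι] [Nonempty ι] (a : ι → ℝ)
    (ha : ∀ i, |a i| ≤ 1) :
    ∑ x : ι → Bool, (∑ i, a i * boolSign (x i)) ^ 8 ≤
      2 ^ Fintype.card ι * (161280 * (Fintype.card ι : ℝ) ^ 4) := by
  set n : ℝ := (Fintype.card ι : ℝ) with hn
  have hn0 : 0 < n := by rw [hn]; exact_mod_cast Fintype.card_pos
  set s := √n with hs
  have hs0 : 0 < s := Real.sqrt_pos.2 hn0
  have hs2 : s ^ 2 = n := Real.sq_sqrt hn0.le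
  have key : ∀ c : ι → ℝ, (∀ i, c i ^ 2 = (a i / s) ^ 2) →
      ∑ x : ι → Bool, Real.exp (∑ i, c i * boolSign (x i)) ≤ 2 ^ Fintype.card ι * 2 := by
    intro c hc
    refine (sum_exp_boolSign_le c).trans ?_
    gcongr
    have h1 : ∑ i, c i ^ 2 / 2 ≤ 1 / 2 := by
      calc ∑ i, c i ^ 2 / 2 ≤ ∑ _i : ι, 1 / n / 2 := by
            refine Finset.sum_le_sum fun i _ => ?_
            rw [hc, div_pow, hs2]
            gcongr
            exact (sq_le_one_iff_abs_le_one _).2 (ha i)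
        _ = 1 / 2 := by
            rw [Finset.sum_const, Finset.card_univ, nsmul_eq_mul, ← hn]
            field_simp
    refine (Real.exp_le_exp.2 h1).trans ?_
    have h2 : Real.exp (1 / 2) ^ 2 = Real.exp 1 := by
      rw [← Real.exp_nat_mul]; norm_num
    nlinarith [Real.exp_one_lt_d9, Real.exp_pos (1 / 2)]
  have h1 := key (fun i => a i / s) fun i => rfl
  have h2 := key (fun i => -(a i / s)) fun i => neg_sq _
  calc ∑ x : ι → Bool, (∑ i, a i * boolSign (x i)) ^ 8
      = n ^ 4 * ∑ x : ι → Bool, (∑ i, a i / s * boolSign (x i)) ^ 8 := by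
        rw [Finset.mul_sum]
        refine Finset.sum_congr rfl fun x _ => ?_
        have : ∑ i, a i * boolSign (x i) = s * ∑ i, a i / s * boolSign (x i) := by
          rw [Finset.mul_sum]
          refine Finset.sum_congr rfl fun i _ => ?_
          field_simp
        rw [this, mul_pow, ← hs2]
        ring
    _ ≤ n ^ 4 * ∑ x : ι → Bool, 40320 * (Real.exp (∑ i, a i / s * boolSign (x i)) +
          Real.exp (∑ i, -(a i / s) * boolSign (x i))) := by
        gcongr with x
        simp only [neg_mul, Finset.sum_neg_distrib]
        exact pow_eight_le_exp _
    _ ≤ n ^ 4 * (40320 * (2 ^ Fintype.card ι * 2 + 2 ^ Fintype.card ι * 2)) := by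
        rw [← Finset.mul_sum, Finset.sum_add_distrib]
        gcongr
    _ = _ := by ring

/-- A weighted pigeonhole principle: some fibre of `f` is large compared with the partition
function of the weight `W`, up to the exponential of the mean weight. -/
lemma exists_large_fiber {V B : Type*} [Fintype V] [Nonempty V] [DecidableEq B] (f : V → B)
    (W : B → ℝ) (μ Z : ℝ) (hμ : ∑ v, W (f v) ≤ Fintype.card V * μ)
    (hZ : ∑ b ∈ Finset.univ.image f, Real.exp (-W b) ≤ Z) :
    ∃ b, Fintype.card V * Real.exp (-μ) ≤ (Finset.univ.filter fun v => f v = b).card * Z := by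
  have hlow : Fintype.card V * Real.exp (-μ) ≤ ∑ v, Real.exp (-W (f v)) := by
    calc Fintype.card V * Real.exp (-μ)
        ≤ Real.exp (-μ) * (Fintype.card V + (Fintype.card V * μ - ∑ v, W (f v))) := by
          nlinarith [Real.exp_pos (-μ)]
      _ = ∑ v, Real.exp (-μ) * (μ - W (f v) + 1) := by
          rw [← Finset.mul_sum, Finset.sum_add_distrib, Finset.sum_sub_distrib]
          simp only [Finset.sum_const, Finset.card_univ, nsmul_eq_mul, mul_one]
          ring
      _ ≤ ∑ v, Real.exp (-W (f v)) := by
          refine Finset.sum_le_sum fun v _ => ?_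
          have : Real.exp (-W (f v)) = Real.exp (-μ) * Real.exp (μ - W (f v)) := by
            rw [← Real.exp_add]; ring_nf
          rw [this]
          gcongr
          exact Real.add_one_le_exp _
  obtain ⟨b, -, hb⟩ := Finset.exists_max_image (Finset.univ.image f)
    (fun b => (Finset.univ.filter fun v => f v = b).card)
    (Finset.univ_nonempty.image f)
  refine ⟨b, hlow.trans ?_⟩
  calc ∑ v, Real.exp (-W (f v))
      = ∑ c ∈ Finset.univ.image f,
          ((Finset.univ.filter fun v => f v = c).card : ℝ) * Real.exp (-W c) := by
        rw [Finset.sum_comp (fun c => Real.exp (-W c)) f]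
        simp only [nsmul_eq_mul]
    _ ≤ ∑ c ∈ Finset.univ.image f,
          ((Finset.univ.filter fun v => f v = b).card : ℝ) * Real.exp (-W c) := by
        refine Finset.sum_le_sum fun c hc => ?_
        exact mul_le_mul_of_nonneg_right (Nat.cast_le.2 (hb c hc)) (Real.exp_pos _).le
    _ ≤ _ := by
        rw [← Finset.mul_sum]
        gcongr

lemma sum_exp_neg_pow_eight_le (T : Finset ℤ) {K : ℝ} (hK : 0 < K) :
    ∑ b ∈ T, Real.exp (-(K * (b : ℝ) ^ 8)) ≤ Real.exp ((∑' b : ℤ, 1 / (b : ℝ) ^ 2) / K) := by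
  have hsum : Summable fun b : ℤ => 1 / (b : ℝ) ^ 2 :=
    Real.summable_one_div_int_pow.2 one_lt_two
  have hterm : ∀ b : ℤ, Real.exp (-(K * (b : ℝ) ^ 8)) ≤
      (if b = 0 then 1 else 0) + 1 / (b : ℝ) ^ 2 / K := by
    intro b
    split_ifs with hb
    · simp [hb]
    · have hb1 : (1 : ℝ) ≤ (b : ℝ) ^ 2 := by
        have : 1 ≤ b ^ 2 := by have := sq_pos_of_ne_zero hb; omega
        exact_mod_cast this
      have h8 : (b : ℝ) ^ 2 ≤ (b : ℝ) ^ 8 := by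
        have := pow_le_pow_right₀ hb1 (show 1 ≤ 4 by norm_num)
        rwa [pow_one, ← pow_mul] at this
      rw [Real.exp_neg, zero_add, div_div, one_div]
      refine inv_anti₀ (by positivity) ?_
      nlinarith [Real.add_one_le_exp (K * (b : ℝ) ^ 8)]
  calc ∑ b ∈ T, Real.exp (-(K * (b : ℝ) ^ 8))
      ≤ ∑ b ∈ T, ((if b = 0 then 1 else 0) + 1 / (b : ℝ) ^ 2 / K) :=
        Finset.sum_le_sum fun b _ => hterm b
    _ ≤ 1 + (∑' b : ℤ, 1 / (b : ℝ) ^ 2) / K := by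
        rw [Finset.sum_add_distrib, ← Finset.sum_div]
        gcongr
        · rw [Finset.sum_ite_eq']
          split_ifs <;> norm_num
        · exact hsum.sum_le_tsum T fun b _ => by positivity
    _ ≤ _ := by linarith [Real.add_one_le_exp ((∑' b : ℤ, 1 / (b : ℝ) ^ 2) / K)]

/-- A set of Boolean vectors of size at least `2 ^ n * exp (-n / 10)` contains two vectors
at Hamming distance at least `n / 4`. -/
lemma exists_far_pair {ι : Type*} [Fintype ι] [Nonempty ι] (X : Finset (ι → Bool))
    (hX : 2 ^ Fintype.card ι * Real.exp (-((Fintype.card ι : ℝ) / 10)) ≤ X.card) :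
    ∃ x ∈ X, ∃ y ∈ X, Fintype.card ι ≤ 4 * hammingDist x y := by
  classical
  set n := Fintype.card ι with hn
  have hn0 : 0 < n := Fintype.card_pos
  have hXpos : 0 < X.card := by
    have : (0 : ℝ) < X.card := lt_of_lt_of_le (by positivity) hX
    exact_mod_cast this
  obtain ⟨x, hx⟩ := Finset.card_pos.1 hXpos
  refine ⟨x, hx, ?_⟩
  by_contra! hfar
  have hgen : ∑ y : ι → Bool, (1 / 2 : ℝ) ^ hammingDist x y = (3 / 2) ^ n := by
    have h1 : ∀ y : ι → Bool, (1 / 2 : ℝ) ^ hammingDist x y =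
        ∏ i, if x i = y i then 1 else 1 / 2 := by
      intro y
      rw [Finset.prod_ite, Finset.prod_const_one, one_mul, Finset.prod_const]
      rfl
    simp only [h1]
    rw [← Fintype.piFinset_univ,
      ← Finset.prod_univ_sum (fun _ => Finset.univ)
        (fun i (b : Bool) => if x i = b then (1 : ℝ) else 1 / 2)]
    rw [hn, ← Finset.card_univ, ← Finset.prod_const]
    refine Finset.prod_congr rfl fun i _ => ?_
    cases x i <;> norm_num
  have hle : (X.card : ℝ) ^ 4 * (1 / 2) ^ n ≤ ((3 / 2) ^ n) ^ 4 := by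
    have hroot : (X.card : ℝ) * (1 / 2 : ℝ) ^ ((n : ℝ) / 4) ≤ (3 / 2) ^ n := by
      rw [← hgen, ← nsmul_eq_mul]
      refine (Finset.card_nsmul_le_sum X (fun y => (1 / 2 : ℝ) ^ hammingDist x y) _ ?_).trans
        (Finset.sum_le_univ_sum_of_nonneg fun y => by positivity)
      intro y hy
      rw [← Real.rpow_natCast]
      refine Real.rpow_le_rpow_of_exponent_ge (by norm_num) (by norm_num) ?_
      have : 4 * (hammingDist x y : ℝ) ≤ n := by exact_mod_cast (hfar y hy).le
      linarith
    have h4 : ((1 / 2 : ℝ) ^ ((n : ℝ) / 4)) ^ 4 = (1 / 2) ^ n := by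
      rw [← Real.rpow_natCast, ← Real.rpow_mul (by norm_num), ← Real.rpow_natCast]
      congr 1
      push_cast
      ring
    rw [← h4, ← mul_pow]
    gcongr
  have hexp : (2 ^ n * Real.exp (-((n : ℝ) / 10))) ^ 4 * (1 / 2) ^ n =
      (8 * Real.exp (-(2 / 5))) ^ n := by
    have : Real.exp (-((n : ℝ) / 10)) ^ 4 = Real.exp (-(2 / 5)) ^ n := by
      rw [← Real.exp_nat_mul, ← Real.exp_nat_mul]
      congr 1
      push_cast
      ring
    rw [mul_pow, this, ← pow_mul, mul_comm n 4, pow_mul, ← mul_pow, ← mul_pow]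
    norm_num
    ring_nf
  have hbase : (81 / 16 : ℝ) < 8 * Real.exp (-(2 / 5)) := by
    have h5 : Real.exp (2 / 5) ^ 5 = Real.exp 1 ^ 2 := by
      rw [← Real.exp_nat_mul, ← Real.exp_nat_mul]; norm_num
    have hlt : Real.exp (2 / 5) < 128 / 81 := by
      refine lt_of_pow_lt_pow_left₀ 5 (by norm_num) ?_
      rw [h5]
      have := Real.exp_one_lt_d9
      have h0 := Real.exp_pos 1
      calc Real.exp 1 ^ 2 < 2.7182818286 ^ 2 := by gcongr
        _ < _ := by norm_num
    rw [Real.exp_neg, ← div_eq_mul_inv, lt_div_iff₀ (Real.exp_pos _)]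
    linarith
  have h1 : (2 ^ n * Real.exp (-((n : ℝ) / 10))) ^ 4 * (1 / 2) ^ n ≤
      (X.card : ℝ) ^ 4 * (1 / 2) ^ n := by gcongr
  have h2 : ((3 / 2 : ℝ) ^ n) ^ 4 = (81 / 16) ^ n := by
    rw [← pow_mul, mul_comm, pow_mul]; norm_num
  have h3 : (81 / 16 : ℝ) ^ n < (8 * Real.exp (-(2 / 5))) ^ n :=
    pow_lt_pow_left₀ hbase (by norm_num) hn0.ne'
  linarith

lemma abs_round_le_two_mul (y : ℝ) : |(round y : ℝ)| ≤ 2 * |y| := by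
  by_cases h : round y = 0
  · simp [h]
  · have h1 : (1 : ℝ) ≤ |(round y : ℝ)| := by
      exact_mod_cast Int.one_le_abs h
    have h2 := abs_sub_round y
    have h3 : |(round y : ℝ)| ≤ |y| + |y - round y| := by
      have := abs_sub y (y - round y)
      simpa using this
    linarith

/-- The partial colouring lemma. -/
lemma exists_partial_coloring :
    ∃ D : ℝ, 0 < D ∧ ∀ (ι κ : Type) [Fintype ι] [Fintype κ] [Nonempty ι] [Nonempty κ]
      (a : κ → ι → ℝ), (∀ k i, |a k i| ≤ 1) →
      ∃ z : ι → ℝ, (∀ i, z i = 0 ∨ z i = 1 ∨ z i = -1) ∧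
        Fintype.card ι ≤ 4 * (Finset.univ.filter fun i => z i ≠ 0).card ∧
        ∀ k, |∑ i, a k i * z i| ≤ D * √√(Fintype.card κ * Fintype.card ι) := by
  classical
  set c : ℝ := ∑' b : ℤ, 1 / (b : ℝ) ^ 2 with hc
  have hc0 : 0 ≤ c := tsum_nonneg fun b => by positivity
  set L : ℝ := 20 * c + 1 with hL
  have hL1 : 1 ≤ L := by linarith
  set D : ℝ := 20 * 256 * 161280 * L with hD
  have hD1 : 1 ≤ D := by linarith
  refine ⟨D, by linarith, fun ι κ _ _ _ _ a ha => ?_⟩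
  set n : ℝ := (Fintype.card ι : ℝ) with hn
  set m : ℝ := (Fintype.card κ : ℝ) with hm
  have hn0 : 0 < n := by rw [hn]; exact_mod_cast Fintype.card_pos
  have hm0 : 0 < m := by rw [hm]; exact_mod_cast Fintype.card_pos
  set Δ : ℝ := D * √√(m * n) with hΔ
  have hΔ0 : 0 < Δ := by positivity
  have hΔ8 : Δ ^ 8 = D ^ 8 * (m ^ 2 * n ^ 2) := by
    have h4 : √√(m * n) ^ 4 = m * n := by
      rw [show 4 = 2 * 2 by norm_num, pow_mul, Real.sq_sqrt (by positivity),
        Real.sq_sqrt (by positivity)]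
    rw [hΔ, mul_pow, show 8 = 4 * 2 by norm_num, pow_mul √√(m * n), h4]
    ring
  set K : ℝ := L * m / n with hK
  have hK0 : 0 < K := by positivity
  set S : (ι → Bool) → κ → ℝ := fun x k => ∑ i, a k i * boolSign (x i) with hS
  set f : (ι → Bool) → κ → ℤ := fun x k => round (S x k / Δ) with hf
  have hcardV : (Fintype.card (ι → Bool) : ℝ) = 2 ^ Fintype.card ι := by
    simp
  have hmean : ∑ x, ∑ k, K * (f x k : ℝ) ^ 8 ≤ Fintype.card (ι → Bool) * (n / 20) := by
    rw [Finset.sum_comm]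
    calc ∑ k, ∑ x, K * (f x k : ℝ) ^ 8
        ≤ ∑ _k : κ, K * (256 / Δ ^ 8) * (2 ^ Fintype.card ι * (161280 * n ^ 4)) := by
          refine Finset.sum_le_sum fun k _ => ?_
          calc ∑ x, K * (f x k : ℝ) ^ 8
              ≤ ∑ x : ι → Bool, K * (256 / Δ ^ 8) * S x k ^ 8 := by
                refine Finset.sum_le_sum fun x _ => ?_
                rw [mul_assoc]
                gcongr
                have h1 := pow_le_pow_left₀ (abs_nonneg _)
                  (abs_round_le_two_mul (S x k / Δ)) 8
                rw [mul_pow, Even.pow_abs (by decide), Even.pow_abs (by decide), div_pow] at h1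
                refine h1.trans_eq ?_
                ring
            _ ≤ _ := by
                rw [← Finset.mul_sum]
                gcongr
                exact sum_pow_eight_boolSign_le (a k) (ha k)
      _ = 2 ^ Fintype.card ι * (n * (256 * 161280 * L) / D ^ 8) := by
          rw [Finset.sum_const, Finset.card_univ, nsmul_eq_mul, ← hm, hΔ8, hK]
          field_simp
      _ ≤ _ := by
          rw [hcardV]
          refine mul_le_mul_of_nonneg_left ?_ (by positivity)
          rw [div_le_div_iff₀ (by positivity) (by norm_num)]
          have : D ≤ D ^ 8 := le_self_pow₀ hD1 (by norm_num)
          calc n * (256 * 161280 * L) * 20 = n * D := by rw [hD]; ring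
            _ ≤ n * D ^ 8 := by gcongr
  have hpart : ∑ b ∈ Finset.univ.image f, Real.exp (-∑ k, K * (b k : ℝ) ^ 8) ≤
      Real.exp (n / 20) := by
    calc ∑ b ∈ Finset.univ.image f, Real.exp (-∑ k, K * (b k : ℝ) ^ 8)
        ≤ ∑ b ∈ Fintype.piFinset fun k => Finset.univ.image fun x => f x k,
            Real.exp (-∑ k, K * (b k : ℝ) ^ 8) := by
          refine Finset.sum_le_sum_of_subset_of_nonneg ?_ fun _ _ _ => by positivity
          intro b hb
          obtain ⟨x, -, rfl⟩ := Finset.mem_image.1 hb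
          exact Fintype.mem_piFinset.2 fun k => Finset.mem_image_of_mem _ (Finset.mem_univ x)
      _ = ∏ k, ∑ b ∈ Finset.univ.image fun x => f x k, Real.exp (-(K * (b : ℝ) ^ 8)) := by
          rw [Finset.prod_univ_sum]
          simp only [← Finset.sum_neg_distrib, Real.exp_sum]
      _ ≤ ∏ _k : κ, Real.exp (c / K) :=
          Finset.prod_le_prod (fun k _ => by positivity)
            fun k _ => sum_exp_neg_pow_eight_le _ hK0
      _ = Real.exp (m * (c / K)) := by
          rw [Finset.prod_const, Finset.card_univ, ← Real.exp_nat_mul]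
      _ ≤ Real.exp (n / 20) := by
          refine Real.exp_le_exp.2 ?_
          have : m * (c / K) = n * c / L := by rw [hK]; field_simp
          rw [this, div_le_div_iff₀ (by positivity) (by norm_num)]
          nlinarith
  obtain ⟨b, hb⟩ := exists_large_fiber f (fun b => ∑ k, K * (b k : ℝ) ^ 8) _ _ hmean hpart
  obtain ⟨x, hx, y, hy, hxy⟩ := exists_far_pair (Finset.univ.filter fun x => f x = b) (by
    rw [hcardV] at hb
    have h1 : Real.exp (-(n / 10)) = Real.exp (-(n / 20)) * Real.exp (-(n / 20)) := by
      rw [← Real.exp_add]; ring_nf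
    have h2 : Real.exp (n / 20) * Real.exp (-(n / 20)) = 1 := by
      rw [← Real.exp_add]; simp
    rw [← hn, h1, ← mul_assoc]
    refine (mul_le_mul_of_nonneg_right hb (Real.exp_pos _).le).trans_eq ?_
    rw [mul_assoc, h2, mul_one])
  refine ⟨fun i => (boolSign (x i) - boolSign (y i)) / 2, fun i => ?_, ?_, fun k => ?_⟩
  · rcases h : x i <;> rcases h' : y i <;> norm_num [boolSign, h, h']
  · refine hxy.trans_eq (congrArg (4 * ·) (congrArg Finset.card ?_))
    refine Finset.filter_congr fun i _ => ?_
    rcases h : x i <;> rcases h' : y i <;> norm_num [boolSign, h, h']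
  · have hfx : round (S x k / Δ) = b k := congrFun (Finset.mem_filter.1 hx).2 k
    have hfy : round (S y k / Δ) = b k := congrFun (Finset.mem_filter.1 hy).2 k
    have h1 := abs_le.1 (abs_sub_round (S x k / Δ))
    have h2 := abs_le.1 (abs_sub_round (S y k / Δ))
    rw [hfx] at h1
    rw [hfy] at h2
    have h3 : |(S x k - S y k) / Δ| ≤ 1 := by
      rw [sub_div, abs_le]
      constructor <;> linarith
    rw [abs_div, abs_of_pos hΔ0, div_le_one hΔ0] at h3
    have h4 : ∑ i, a k i * ((boolSign (x i) - boolSign (y i)) / 2) = (S x k - S y k) / 2 := by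
      simp only [hS]
      rw [← Finset.sum_sub_distrib, Finset.sum_div]
      exact Finset.sum_congr rfl fun i _ => by ring
    rw [h4, abs_div, abs_two]
    linarith

/-- Iterating partial colourings: `m` linear forms in `n` variables have a sign vector of
discrepancy `O((m n) ^ (1 / 4))`. -/
lemma exists_coloring :
    ∃ C : ℝ, 0 < C ∧ ∀ (κ : Type) [Fintype κ] [Nonempty κ] (n : ℕ) (ι : Type) [Fintype ι]
      (a : κ → ι → ℝ), Fintype.card ι = n → (∀ k i, |a k i| ≤ 1) →
      ∃ x : ι → ℝ, (∀ i, x i = 1 ∨ x i = -1) ∧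
        ∀ k, |∑ i, a k i * x i| ≤ C * √√(Fintype.card κ * n) := by
  classical
  obtain ⟨D, hD0, hD⟩ := exists_partial_coloring
  refine ⟨16 * D, by positivity, fun κ _ _ n => ?_⟩
  induction n using Nat.strong_induction_on with
  | _ n ih =>
  intro ι _ a hcard ha
  rcases isEmpty_or_nonempty ι with hι | hι
  · exact ⟨fun _ => 1, fun _ => Or.inl rfl, fun k => by
      rw [Finset.univ_eq_empty, Finset.sum_empty, abs_zero]; positivity⟩
  obtain ⟨z, hz, hzcard, hza⟩ := hD ι κ a ha
  have hpos : 0 < Fintype.card ι := Fintype.card_pos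
  have hsplit : Fintype.card {i // z i = 0} + (Finset.univ.filter fun i => z i ≠ 0).card = n := by
    rw [Fintype.card_subtype, ← hcard, ← Finset.card_univ,
      Finset.card_filter_add_card_filter_not]
  obtain ⟨x, hx, hxa⟩ := ih (Fintype.card {i // z i = 0}) (by omega) {i // z i = 0}
    (fun k i => a k i) rfl fun k i => ha k i
  refine ⟨fun i => if h : z i = 0 then x ⟨i, h⟩ else z i, fun i => ?_, fun k => ?_⟩
  · by_cases h : z i = 0
    · simpa [h] using hx ⟨i, h⟩
    · simpa [h] using hz i
  have hsum : ∑ i, a k i * (if h : z i = 0 then x ⟨i, h⟩ else z i) =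
      ∑ i, a k i * z i + ∑ i : {i // z i = 0}, a k i * x i := by
    have h1 : ∑ i : {i // z i = 0}, a k i * x i =
        ∑ i, if h : z i = 0 then a k i * x ⟨i, h⟩ else 0 := by
      rw [Finset.sum_dite, Finset.sum_const_zero, add_zero]
      exact Finset.sum_bij' (fun i _ => ⟨i.1, by simp [i.2]⟩)
        (fun i _ => ⟨i.1, (Finset.mem_filter.1 i.2).2⟩)
        (by simp) (by simp) (by simp) (by simp) (by simp)
    rw [h1, ← Finset.sum_add_distrib]
    refine Finset.sum_congr rfl fun i _ => ?_
    by_cases h : z i = 0 <;> simp [h]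
  have hroot : √√(Fintype.card κ * Fintype.card {i // z i = 0}) ≤
      15 / 16 * √√(Fintype.card κ * n) := by
    have hle : (4 : ℝ) * Fintype.card {i // z i = 0} ≤ 3 * n := by
      have : 4 * Fintype.card {i // z i = 0} ≤ 3 * n := by omega
      exact_mod_cast this
    have hm0 : (0 : ℝ) ≤ Fintype.card κ := by positivity
    refine Real.sqrt_le_iff.2 ⟨by positivity, ?_⟩
    refine Real.sqrt_le_iff.2 ⟨by positivity, ?_⟩
    rw [← pow_mul, mul_pow, pow_mul √√_, Real.sq_sqrt (by positivity),
      Real.sq_sqrt (by positivity)]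
    nlinarith [mul_le_mul_of_nonneg_left hle hm0, mul_nonneg hm0 (Nat.cast_nonneg (α := ℝ) n)]
  rw [hsum]
  have h1 := hza k
  rw [hcard] at h1
  have h2 := hxa k
  have h3 := mul_le_mul_of_nonneg_left hroot (by positivity : (0 : ℝ) ≤ 16 * D)
  have h4 := abs_add_le (∑ i, a k i * z i) (∑ i : {i // z i = 0}, a k i * x i)
  linarith

/-- **Spencer's theorem.** There is an absolute constant `C > 0` such that for every
`n ≥ 1` and every `n × n` real matrix `A` with all entries of absolute value at most `1`,
there is a sign vector `x ∈ {-1,1}^n` with `‖Ax‖_∞ ≤ C √n`. -/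
theorem spencer_six_deviations :
    ∃ C : ℝ, 0 < C ∧
      ∀ n : ℕ, 1 ≤ n → ∀ A : Matrix (Fin n) (Fin n) ℝ,
        (∀ i j, |A i j| ≤ 1) →
        ∃ x : Fin n → ℝ, (∀ i, x i = 1 ∨ x i = -1) ∧
          ∀ i, |A.mulVec x i| ≤ C * Real.sqrt n := by
  obtain ⟨C, hC0, hC⟩ := exists_coloring
  refine ⟨C, hC0, fun n hn A hA => ?_⟩
  have : Nonempty (Fin n) := ⟨⟨0, hn⟩⟩
  obtain ⟨x, hx, hxA⟩ := hC (Fin n) n (Fin n) A (Fintype.card_fin n) hA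
  refine ⟨x, hx, fun i => ?_⟩
  have h := hxA i
  rwa [Fintype.card_fin, Real.sqrt_mul_self (Nat.cast_nonneg n)] at h
end

section
/- For every ε > 0 there exists d₀ such that the following holds: if G is a triangle-free graph on n vertices whose average degree d satisfies d ≥ d₀, then the independence number of G satisfies α(G) ≥ (1 - ε) · n · (log d) / d. -/
/-- The number of ordered pairs of adjacent vertices of `S`. -/
noncomputable def SimpleGraph.adjPairs {V : Type*} (G : SimpleGraph V) [DecidableRel G.Adj]
    (S : Finset V) : ℝ :=
  ∑ x ∈ S, ∑ y ∈ S, if G.Adj x y then 1 else 0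

section Graph

open Finset

variable {V : Type*} {G : SimpleGraph V} [DecidableRel G.Adj]

theorem SimpleGraph.adjPairs_nonneg (S : Finset V) : 0 ≤ G.adjPairs S :=
  sum_nonneg fun _ _ => sum_nonneg fun _ _ => by split_ifs <;> norm_num

/-- Deleting a closed neighbourhood in a triangle-free graph removes at least as many ordered
adjacent pairs as twice the sum of the degrees of the neighbours. -/
theorem SimpleGraph.adjPairs_filter_le [DecidableEq V] (hG : G.CliqueFree 3) (S : Finset V) (v : V) :
    G.adjPairs (S.filter fun x => x ≠ v ∧ ¬ G.Adj v x) ≤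
      G.adjPairs S - 2 * ∑ u ∈ S, (if G.Adj v u then 1 else 0) *
        ∑ y ∈ S, (if G.Adj u y then (1 : ℝ) else 0) := by
  have hsym : ∑ u ∈ S, (if G.Adj v u then 1 else 0) * ∑ y ∈ S, (if G.Adj u y then (1 : ℝ) else 0)
      = ∑ x ∈ S, ∑ y ∈ S, (if G.Adj v y then 1 else 0) * (if G.Adj x y then (1 : ℝ) else 0) := by
    simp_rw [mul_sum]
    rw [sum_comm]
    simp_rw [G.adj_comm]
  rw [two_mul, le_sub_iff_add_le]
  nth_rewrite 2 [hsym]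
  simp only [SimpleGraph.adjPairs, sum_filter, mul_sum, ← sum_add_distrib]
  refine sum_le_sum fun x _ => ?_
  have key : ∀ y, G.Adj v x → G.Adj v y → ¬ G.Adj x y := fun y h1 h2 h3 =>
    hG {v, x, y} (SimpleGraph.is3Clique_triple_iff.2 ⟨h1, h2, h3⟩)
  split_ifs with h1 h2
  · exact absurd h2 h1.2
  · rw [← sum_add_distrib]
    refine sum_le_sum fun y _ => ?_
    split_ifs <;> simp_all
  · rw [zero_add]
    refine sum_le_sum fun y _ => ?_
    have := key y
    split_ifs <;> simp_all
  · rw [zero_add]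
    refine sum_le_sum fun y _ => ?_
    split_ifs <;> simp_all

theorem SimpleGraph.card_filter_nonadj [DecidableEq V] {S : Finset V} {v : V} (hv : v ∈ S) :
    ((S.filter fun x => x ≠ v ∧ ¬ G.Adj v x).card : ℝ) =
      S.card - 1 - ∑ y ∈ S, if G.Adj v y then (1 : ℝ) else 0 := by
  have h1 : (S.card : ℝ) - 1 = ∑ x ∈ S, (1 - if x = v then 1 else 0) := by simp [hv]
  rw [h1, card_filter, ← sum_sub_distrib]
  push_cast
  refine sum_congr rfl fun x _ => ?_
  by_cases hx : x = v
  · subst hx; simp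
  · by_cases h : G.Adj v x <;> simp [hx, h]

/-- **Shearer's induction.** If `f` is bounded below on `[0, ∞)` by lines of nonpositive slope
`f'` and satisfies Shearer's differential inequality, then a triangle-free graph with `n` vertices
and average degree `d` has an independent set of size at least `n * f d`. -/
theorem SimpleGraph.exists_indep_of_differential_ineq [DecidableEq V] (hG : G.CliqueFree 3) {f f' : ℝ → ℝ}
    (hf : ∀ x y, 0 ≤ x → 0 ≤ y → f x + f' x * (y - x) ≤ f y) (hf' : ∀ x, 0 ≤ x → f' x ≤ 0)
    (hode : ∀ x, 0 ≤ x → (x + 1) * f x ≤ 1 + f' x * (x - x ^ 2)) (S : Finset V) :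
    ∃ s ⊆ S, (∀ x ∈ s, ∀ y ∈ s, x ≠ y → ¬ G.Adj x y) ∧
      S.card * f (G.adjPairs S / S.card) ≤ s.card := by
  induction S using Finset.strongInduction with | H S ih
  rcases S.eq_empty_or_nonempty with rfl | hS
  · exact ⟨∅, by simp⟩
  have hn : (0 : ℝ) < S.card := by exact_mod_cast hS.card_pos
  set n : ℝ := (S.card : ℝ) with hn_def
  set d := G.adjPairs S / n with hd_def
  have hE : G.adjPairs S = d * n := by rw [hd_def]; field_simp
  have hd : 0 ≤ d := div_nonneg (SimpleGraph.adjPairs_nonneg S) hn.le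
  let D : V → ℝ := fun x => ∑ y ∈ S, if G.Adj x y then 1 else 0
  let T : V → ℝ := fun v => ∑ u ∈ S, (if G.Adj v u then 1 else 0) * D u
  have hD : ∑ v ∈ S, D v = d * n := hE
  have hT : d ^ 2 * n ≤ ∑ v ∈ S, T v := by
    have h1 : ∑ v ∈ S, T v = ∑ u ∈ S, D u ^ 2 := by
      rw [sum_comm]
      refine sum_congr rfl fun u _ => ?_
      rw [← sum_mul, sq]
      simp only [D, G.adj_comm]
    have h2 := sq_sum_le_card_mul_sum_sq (s := S) (f := D)
    rw [hD, ← h1, ← hn_def] at h2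
    nlinarith
  obtain ⟨v, hv, hle⟩ : ∃ v ∈ S, n * f d ≤
      1 + (n - 1 - D v) * f d + f' d * (d * n - 2 * T v - d * (n - 1 - D v)) := by
    refine exists_le_of_sum_le hS ?_
    have hsum : ∑ v ∈ S, (1 + (n - 1 - D v) * f d
        + f' d * (d * n - 2 * T v - d * (n - 1 - D v))) =
        n * (1 + (n - 1) * f d + f' d * d) - (f d - f' d * d) * ∑ v ∈ S, D v
          - 2 * f' d * ∑ v ∈ S, T v := by
      rw [hn_def, ← nsmul_eq_mul, ← sum_const, mul_sum, mul_sum, ← sum_sub_distrib,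
        ← sum_sub_distrib]
      exact sum_congr rfl fun v _ => by ring
    rw [hsum, sum_const, nsmul_eq_mul, ← hn_def, hD]
    have h1 := mul_le_mul_of_nonpos_left hT (hf' d hd)
    have h2 := mul_le_mul_of_nonneg_left (hode d hd) hn.le
    nlinarith
  set S' := S.filter fun x => x ≠ v ∧ ¬ G.Adj v x with hS'
  have hlt : S' ⊂ S := filter_ssubset.2 ⟨v, hv, by simp⟩
  have hcard : (S'.card : ℝ) = n - 1 - D v := SimpleGraph.card_filter_nonadj hv
  have hpairs : G.adjPairs S' ≤ d * n - 2 * T v :=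
    hE ▸ SimpleGraph.adjPairs_filter_le hG S v
  obtain ⟨s, hsS, hs, hsc⟩ := ih S' hlt
  have hvs : v ∉ s := fun h => by simpa [hS'] using hsS h
  have hnadj : ∀ x ∈ s, ¬ G.Adj v x := fun x hx => (mem_filter.1 (hsS hx)).2.2
  refine ⟨insert v s, insert_subset hv (hsS.trans hlt.1), ?_, ?_⟩
  · intro x hx y hy hxy
    rcases mem_insert.1 hx with rfl | hxs <;> rcases mem_insert.1 hy with rfl | hys
    · exact absurd rfl hxy
    · exact hnadj y hys
    · exact fun h => hnadj x hxs h.symm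
    · exact hs x hxs y hys hxy
  · rw [card_insert_of_notMem hvs]
    push_cast
    have hline : S'.card * f d + f' d * (G.adjPairs S' - d * S'.card) ≤
        S'.card * f (G.adjPairs S' / S'.card) := by
      rcases S'.eq_empty_or_nonempty with h | h
      · simp [h, SimpleGraph.adjPairs]
      · have hn' : (0 : ℝ) < S'.card := by exact_mod_cast h.card_pos
        have := mul_le_mul_of_nonneg_left (hf d (G.adjPairs S' / S'.card) hd
          (div_nonneg (SimpleGraph.adjPairs_nonneg S') hn'.le)) hn'.le
        rwa [mul_add, mul_left_comm, mul_sub, mul_div_cancel₀ _ hn'.ne', mul_comm _ d] at this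
    have := mul_le_mul_of_nonpos_left hpairs (hf' d hd)
    rw [hcard] at hline hsc
    linarith

end Graph

section Profile

open Real

/-- A convex decreasing function with `shearerProfile s ~ log s / s`: it is
`(log s + 3 / 2) / s` for `1 ≤ s`, continued by its tangent at `1`. -/
noncomputable def shearerProfile (s : ℝ) : ℝ :=
  if s ≤ 1 then 2 - s / 2 else (log s + 3 / 2) / s

/-- The derivative of `shearerProfile`. -/
noncomputable def shearerSlope (s : ℝ) : ℝ :=
  if s ≤ 1 then -(1 / 2) else -(log s + 1 / 2) / s ^ 2

theorem shearerProfile_of_one_le {s : ℝ} (hs : 1 ≤ s) :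
    shearerProfile s = (log s + 3 / 2) / s := by
  rcases hs.eq_or_lt with rfl | hs
  · norm_num [shearerProfile]
  · rw [shearerProfile, if_neg hs.not_ge]

theorem shearerSlope_of_one_le {s : ℝ} (hs : 1 ≤ s) :
    shearerSlope s = -(log s + 1 / 2) / s ^ 2 := by
  rcases hs.eq_or_lt with rfl | hs
  · norm_num [shearerSlope]
  · rw [shearerSlope, if_neg hs.not_ge]

theorem shearerSlope_nonpos (s : ℝ) : shearerSlope s ≤ 0 := by
  unfold shearerSlope
  split_ifs with h
  · norm_num
  · have := log_nonneg (not_le.1 h).le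
    exact div_nonpos_of_nonpos_of_nonneg (by linarith) (sq_nonneg s)

theorem neg_half_le_shearerSlope (s : ℝ) : -(1 / 2) ≤ shearerSlope s := by
  unfold shearerSlope
  split_ifs with h
  · exact le_rfl
  · have hs : 0 < s := by linarith
    have := log_le_sub_one_of_pos hs
    rw [le_div_iff₀ (by positivity)]
    nlinarith [sq_nonneg (s - 1)]

theorem Real.quadratic_le_log {r : ℝ} (hr : 1 ≤ r) :
    2 * r - r ^ 2 / 2 - 3 / 2 ≤ log r := by
  have h := le_log_one_add_of_nonneg (sub_nonneg.2 hr)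
  rw [add_sub_cancel] at h
  refine le_trans ?_ h
  rw [le_div_iff₀ (by linarith)]
  nlinarith [pow_nonneg (sub_nonneg.2 hr) 3]

theorem Real.log_le_sub_inv_div_two {u : ℝ} (hu : 1 ≤ u) : log u ≤ (u - u⁻¹) / 2 := by
  rw [← sinh_log (by linarith)]
  exact self_le_sinh_iff.2 (log_nonneg hu)

theorem shearerProfile_tangent_le_of_one_le {s y : ℝ} (hs : 1 ≤ s) (hy : 1 ≤ y) :
    shearerProfile s + shearerSlope s * (y - s) ≤ shearerProfile y := by
  have hs0 : 0 < s := by linarith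
  have hy0 : 0 < y := by linarith
  rw [shearerProfile_of_one_le hs, shearerProfile_of_one_le hy, shearerSlope_of_one_le hs,
    le_div_iff₀ hy0]
  obtain ⟨r, hr0, rfl⟩ : ∃ r, 0 < r ∧ y = s * r := ⟨y / s, by positivity, by field_simp⟩
  rw [log_mul hs0.ne' hr0.ne']
  have hlhs : ((log s + 3 / 2) / s + -(log s + 1 / 2) / s ^ 2 * (s * r - s)) * (s * r) =
      (log s + 3 / 2) * r - (log s + 1 / 2) * (r ^ 2 - r) := by
    field_simp
    ring
  rw [hlhs]
  have hls := log_nonneg hs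
  rcases le_total 1 r with hr | hr
  · nlinarith [quadratic_le_log hr, mul_nonneg hls (sq_nonneg (r - 1))]
  · have hly := log_nonneg hy
    rw [log_mul hs0.ne' hr0.ne'] at hly
    have h1 := log_le_sub_inv_div_two ((one_le_inv₀ hr0).2 hr)
    rw [log_inv, inv_inv] at h1
    have h2 : (r⁻¹ - r) / 2 * (r * (2 - r)) = (1 - r ^ 2) * (2 - r) / 2 := by
      field_simp
    have h3 := mul_le_mul_of_nonneg_right h1 (by nlinarith : 0 ≤ r * (2 - r))
    rw [h2] at h3
    nlinarith [mul_nonneg hly (sq_nonneg (r - 1)), pow_nonneg (sub_nonneg.2 hr) 3]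

theorem shearerProfile_tangent_le (s y : ℝ) :
    shearerProfile s + shearerSlope s * (y - s) ≤ shearerProfile y := by
  rcases le_total s 1 with hs | hs <;> rcases le_total y 1 with hy | hy
  · simp only [shearerProfile, shearerSlope, if_pos hs, if_pos hy]
    linarith
  · have := shearerProfile_tangent_le_of_one_le le_rfl hy
    simp only [shearerProfile, shearerSlope, if_pos hs, if_pos le_rfl] at this ⊢
    linarith
  · have := shearerProfile_tangent_le_of_one_le hs le_rfl
    have h1 : shearerProfile 1 = 2 - 1 / 2 := if_pos le_rfl
    have h2 : shearerProfile y = 2 - y / 2 := if_pos hy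
    rw [h1] at this
    rw [h2]
    nlinarith [neg_half_le_shearerSlope s]
  · exact shearerProfile_tangent_le_of_one_le hs hy

theorem shearerProfile_differential_ineq {c k s : ℝ} (hc : 0 ≤ c) (hk : 0 < k)
    (hck : 2 * c ≤ (1 - c) * k) :
    (k * s + 1) * (c / k * shearerProfile s) ≤
      1 + c / k ^ 2 * shearerSlope s * (k * s - (k * s) ^ 2) := by
  have hck' : 2 * (c / k) ≤ 1 - c := by
    rw [← mul_div_assoc, div_le_iff₀ hk]; exact hck
  have hck0 : 0 ≤ c / k := by positivity
  have hl : (k * s + 1) * (c / k * shearerProfile s) =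
      c * s * shearerProfile s + c / k * shearerProfile s := by field_simp
  have hr : 1 + c / k ^ 2 * shearerSlope s * (k * s - (k * s) ^ 2) =
      1 + c / k * (shearerSlope s * s) - c * (shearerSlope s * s ^ 2) := by
    field_simp
    ring
  rw [hl, hr]
  rcases le_total s 1 with hs | hs
  · simp only [shearerProfile, shearerSlope, if_pos hs]
    nlinarith [mul_nonneg hc (sq_nonneg (s - 1))]
  · have hs0 : 0 < s := by linarith
    rw [shearerProfile_of_one_le hs, shearerSlope_of_one_le hs]
    have h1 : c * s * ((log s + 3 / 2) / s) = c * (log s + 3 / 2) := by field_simp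
    have h2 : -(log s + 1 / 2) / s ^ 2 * s = -(log s + 1 / 2) / s := by field_simp
    have h3 : -(log s + 1 / 2) / s ^ 2 * s ^ 2 = -(log s + 1 / 2) := by field_simp
    rw [h1, h2, h3]
    have h4 : (log s + 3 / 2) / s - -(log s + 1 / 2) / s ≤ 2 := by
      rw [← sub_div, div_le_iff₀ hs0]
      linarith [log_le_sub_one_of_pos hs0]
    nlinarith [mul_le_mul_of_nonneg_left h4 hck0]

end Profile

theorem SimpleGraph.adjPairs_univ {V : Type*} [Fintype V] (G : SimpleGraph V)
    [DecidableRel G.Adj] : G.adjPairs Finset.univ = 2 * G.edgeSet.ncard := by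
  classical
  have h := G.sum_degrees_eq_twice_card_edges
  rw [← coe_edgeFinset, Set.ncard_coe_finset]
  rw [adjPairs]
  simp only [Finset.sum_boole, ← neighborFinset_eq_filter, card_neighborFinset_eq_degree]
  exact_mod_cast h

open Real in
/-- Triangle-free graphs of average degree `d ≥ k` have independent sets of size about
`c * n * log (d / k) / d`, where `c < 1` and `k` is large in terms of `1 - c`. -/
theorem SimpleGraph.exists_indep_log_div {V : Type*} [Fintype V] {G : SimpleGraph V}
    (hG : G.CliqueFree 3) {c k d : ℝ} (hc : 0 ≤ c) (hk : 0 < k) (hck : 2 * c ≤ (1 - c) * k)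
    (hd : d = 2 * G.edgeSet.ncard / Fintype.card V) (hkd : k ≤ d) :
    ∃ s : Finset V, (∀ x ∈ s, ∀ y ∈ s, x ≠ y → ¬ G.Adj x y) ∧
      Fintype.card V * (c * (log (d / k) + 3 / 2) / d) ≤ s.card := by
  classical
  obtain ⟨s, -, hs, hsc⟩ := exists_indep_of_differential_ineq hG
    (f := fun x => c / k * shearerProfile (x / k)) (f' := fun x => c / k ^ 2 * shearerSlope (x / k))
    (fun x y _ _ => by
      refine le_of_eq_of_le ?_ (mul_le_mul_of_nonneg_left
        (shearerProfile_tangent_le (x / k) (y / k)) (div_nonneg hc hk.le))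
      field_simp)
    (fun x _ => mul_nonpos_of_nonneg_of_nonpos (by positivity) (shearerSlope_nonpos _))
    (fun x _ => by
      simpa only [mul_div_cancel₀ x hk.ne'] using
        shearerProfile_differential_ineq (s := x / k) hc hk hck)
    Finset.univ
  refine ⟨s, hs, le_of_eq_of_le ?_ hsc⟩
  have hd0 : 0 < d := hk.trans_le hkd
  rw [adjPairs_univ, Finset.card_univ, ← hd, shearerProfile_of_one_le ((one_le_div₀ hk).2 hkd)]
  field_simp

/-- **Shearer's theorem.** For every `ε > 0` there is `d₀` such that every triangle-free
graph `G` on `n` vertices whose average degree `d = 2e(G)/n` satisfies `d ≥ d₀` contains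
an independent set of size at least `(1 - ε) n (log d) / d`. -/
theorem shearer_triangle_free (ε : ℝ) (hε : 0 < ε) :
    ∃ d₀ : ℝ, ∀ (n : ℕ) (G : SimpleGraph (Fin n)), G.CliqueFree 3 →
      ∀ d : ℝ, d = 2 * G.edgeSet.ncard / n → d₀ ≤ d →
        ∃ s : Finset (Fin n), (∀ x ∈ s, ∀ y ∈ s, x ≠ y → ¬ G.Adj x y) ∧
          (1 - ε) * n * Real.log d / d ≤ s.card := by
  rcases le_or_gt 1 ε with h1 | h1
  · refine ⟨1, fun n G _ d _ hd => ⟨∅, by simp, ?_⟩⟩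
    have := Real.log_nonneg hd
    rw [Finset.card_empty, Nat.cast_zero]
    refine div_nonpos_of_nonpos_of_nonneg ?_ (by linarith)
    rw [mul_assoc]
    exact mul_nonpos_of_nonpos_of_nonneg (by linarith) (by positivity)
  · set k : ℝ := 4 / ε with hk_def
    have hk : 0 < k := by positivity
    refine ⟨max k (Real.exp (2 / ε * |Real.log k|)), fun n G hG d hd hle => ?_⟩
    have hkd : k ≤ d := (le_max_left _ _).trans hle
    have hd0 : 0 < d := hk.trans_le hkd
    have hlog : 2 / ε * |Real.log k| ≤ Real.log d :=
      (Real.le_log_iff_exp_le hd0).2 ((le_max_right _ _).trans hle)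
    have hck : 2 * (1 - ε / 2) ≤ (1 - (1 - ε / 2)) * k := by
      have : (1 - (1 - ε / 2)) * k = 2 := by rw [hk_def]; field_simp; ring
      linarith
    obtain ⟨s, hs, hsc⟩ := G.exists_indep_log_div hG (c := 1 - ε / 2) (by linarith) hk hck
      (by rwa [Fintype.card_fin]) hkd
    refine ⟨s, hs, le_trans ?_ hsc⟩
    rw [Fintype.card_fin, ← mul_div_assoc, mul_comm (1 - ε), mul_assoc]
    refine div_le_div_of_nonneg_right (mul_le_mul_of_nonneg_left ?_ n.cast_nonneg) hd0.le
    rw [Real.log_div hd0.ne' hk.ne']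
    have h2 : |Real.log k| ≤ ε / 2 * Real.log d := by
      have := mul_le_mul_of_nonneg_left hlog (by positivity : 0 ≤ ε / 2)
      refine le_of_eq_of_le ?_ this
      field_simp
    have h3 : (1 - ε / 2) * Real.log k ≤ |Real.log k| := by
      nlinarith [le_abs_self (Real.log k), abs_nonneg (Real.log k)]
    nlinarith
end

section
/- For every ε > 0 there exists d₀ such that for all d ≥ d₀ the following holds: there exists L₀ > 0 such that for every L ≥ L₀ there is a finite set S ⊂ [0, L]^d of points with pairwise Euclidean distances at least 2, satisfying |S| · Vol(B₁^d) ≥ (1 - ε) · (d log d / 2^{d+1}) · L^d, where B₁^d is the unit ball in ℝ^d. In particular, the sphere packing density θ(d) satisfies θ(d) ≥ (1 - o(1)) d log d / 2^{d+1} as d → ∞. -/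
open MeasureTheory

/-! ### Expectations over `p`-random subsets of a finite set -/

/-- The expectation of `f S`, where `S` is the random subset of `W` that contains every element of
`W` independently with probability `p`. -/
noncomputable def subsetExp {α : Type*} (p : ℝ) (W : Finset α) (f : Finset α → ℝ) : ℝ :=
  ∑ S ∈ W.powerset, p ^ S.card * (1 - p) ^ (W.card - S.card) * f S

section subsetExp

variable {α : Type*} {p : ℝ} {W : Finset α} {f g : Finset α → ℝ}

lemma subsetExp_congr (h : ∀ S ⊆ W, f S = g S) : subsetExp p W f = subsetExp p W g :=
  Finset.sum_congr rfl fun S hS => by rw [h S (Finset.mem_powerset.1 hS)]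

lemma subsetExp_mono (hp0 : 0 ≤ p) (hp1 : p ≤ 1) (h : ∀ S ⊆ W, f S ≤ g S) :
    subsetExp p W f ≤ subsetExp p W g := by
  refine Finset.sum_le_sum fun S hS => ?_
  have := sub_nonneg.2 hp1
  exact mul_le_mul_of_nonneg_left (h S (Finset.mem_powerset.1 hS)) (by positivity)

lemma subsetExp_const (c : ℝ) : subsetExp p W (fun _ => c) = c := by
  rw [subsetExp, ← Finset.sum_mul, Finset.sum_pow_mul_eq_add_pow]
  simp

lemma subsetExp_add : subsetExp p W (fun S => f S + g S) = subsetExp p W f + subsetExp p W g := by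
  simp only [subsetExp, mul_add, Finset.sum_add_distrib]

lemma subsetExp_sub : subsetExp p W (fun S => f S - g S) = subsetExp p W f - subsetExp p W g := by
  simp only [subsetExp, mul_sub, Finset.sum_sub_distrib]

lemma subsetExp_const_mul (c : ℝ) : subsetExp p W (fun S => c * f S) = c * subsetExp p W f := by
  simp only [subsetExp, Finset.mul_sum]
  exact Finset.sum_congr rfl fun S _ => by ring

lemma subsetExp_sum {ι : Type*} (s : Finset ι) (F : ι → Finset α → ℝ) :
    subsetExp p W (fun S => ∑ i ∈ s, F i S) = ∑ i ∈ s, subsetExp p W (F i) := by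
  simp only [subsetExp, Finset.mul_sum]
  exact Finset.sum_comm

lemma exists_le_of_le_subsetExp (hp0 : 0 ≤ p) (hp1 : p ≤ 1) {c : ℝ} (h : c ≤ subsetExp p W f) :
    ∃ S ⊆ W, c ≤ f S := by
  by_contra! hc
  obtain ⟨T, hT, hmax⟩ := W.powerset.exists_max_image f ⟨∅, by simp⟩
  have h1 : subsetExp p W f ≤ subsetExp p W (fun _ => f T) :=
    subsetExp_mono hp0 hp1 fun S hS => hmax S (Finset.mem_powerset.2 hS)
  rw [subsetExp_const] at h1
  linarith [hc T (Finset.mem_powerset.1 hT)]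

/-- Markov's inequality for the exponential moment. -/
lemma subsetExp_lt_le_exp (hp0 : 0 ≤ p) (hp1 : p ≤ 1) {l t : ℝ} (hl : 0 ≤ l) {P : Finset α → Prop}
    [DecidablePred P] (hP : ∀ S ⊆ W, P S → t ≤ f S) :
    subsetExp p W (fun S => if P S then 1 else 0) ≤
      Real.exp (-(l * t)) * subsetExp p W (fun S => Real.exp (l * f S)) := by
  rw [← subsetExp_const_mul]
  refine subsetExp_mono hp0 hp1 fun S hS => ?_
  rw [← Real.exp_add]
  split_ifs with h
  · rw [Real.one_le_exp_iff]
    nlinarith [mul_le_mul_of_nonneg_left (hP S hS h) hl]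
  · exact (Real.exp_pos _).le

variable [DecidableEq α]

lemma subsetExp_insert {u : α} (hu : u ∉ W) :
    subsetExp p (insert u W) f =
      (1 - p) * subsetExp p W f + p * subsetExp p W (fun S => f (insert u S)) := by
  rw [subsetExp, Finset.sum_powerset_insert hu, subsetExp, subsetExp, Finset.mul_sum,
    Finset.mul_sum]
  congr 1 <;> refine Finset.sum_congr rfl fun S hS => ?_
  · have := Finset.card_le_card (Finset.mem_powerset.1 hS)
    rw [Finset.card_insert_of_notMem hu, Nat.succ_sub this,
      Nat.succ_eq_add_one, pow_succ]
    ring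
  · have : u ∉ S := fun h => hu (Finset.mem_powerset.1 hS h)
    rw [Finset.card_insert_of_notMem hu, Finset.card_insert_of_notMem this,
      Nat.add_sub_add_right]
    ring

/-- The probability that a `p`-random subset contains `A` and avoids `B`. -/
lemma subsetExp_indicator (A B : Finset α) (hAB : Disjoint A B) (hA : A ⊆ W) (hB : B ⊆ W) :
    subsetExp p W (fun S => if A ⊆ S ∧ Disjoint B S then 1 else 0) =
      p ^ A.card * (1 - p) ^ B.card := by
  induction W using Finset.induction_on generalizing A B with
  | empty =>
    obtain rfl := Finset.subset_empty.1 hA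
    obtain rfl := Finset.subset_empty.1 hB
    simp [subsetExp]
  | insert u W hu ih =>
    rw [subsetExp_insert hu]
    by_cases huA : u ∈ A
    · have huB : u ∉ B := Finset.disjoint_left.1 hAB huA
      have h1 : subsetExp p W (fun S => if A ⊆ S ∧ Disjoint B S then (1 : ℝ) else 0) = 0 := by
        refine (subsetExp_congr (g := fun _ => 0) fun S hS => ?_).trans (subsetExp_const 0)
        exact if_neg fun h => hu (hS (h.1 huA))
      have h2 : subsetExp p W
          (fun S => if A ⊆ insert u S ∧ Disjoint B (insert u S) then (1 : ℝ) else 0) =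
          p ^ (A.erase u).card * (1 - p) ^ B.card := by
        rw [← ih (A.erase u) B (hAB.mono_left (Finset.erase_subset _ _))
          (Finset.subset_insert_iff.1 hA) ((Finset.subset_insert_iff_of_notMem huB).1 hB)]
        refine subsetExp_congr fun S hS => ?_
        simp only [Finset.subset_insert_iff, Finset.disjoint_insert_right, huB, not_false_eq_true,
          true_and]
      rw [h1, h2, ← Finset.card_erase_add_one huA]
      ring
    · have hA' := (Finset.subset_insert_iff_of_notMem huA).1 hA
      have h3 : ∀ S, A ⊆ insert u S ↔ A ⊆ S := fun S => Finset.subset_insert_iff_of_notMem huA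
      by_cases huB : u ∈ B
      · have h1 : subsetExp p W
            (fun S => if A ⊆ insert u S ∧ Disjoint B (insert u S) then (1 : ℝ) else 0) = 0 := by
          refine (subsetExp_congr (g := fun _ => 0) fun S hS => ?_).trans (subsetExp_const 0)
          refine if_neg fun h => ?_
          exact Finset.disjoint_left.1 h.2 huB (Finset.mem_insert_self _ _)
        have h2 : subsetExp p W (fun S => if A ⊆ S ∧ Disjoint B S then (1 : ℝ) else 0) =
            p ^ A.card * (1 - p) ^ (B.erase u).card := by
          rw [← ih A (B.erase u) (hAB.mono_right (Finset.erase_subset _ _)) hA'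
            (Finset.subset_insert_iff.1 hB)]
          refine subsetExp_congr fun S hS => ?_
          have : Disjoint (B.erase u) S ↔ Disjoint B S := by
            have huS : u ∉ S := fun h => hu (hS h)
            rw [Finset.disjoint_left, Finset.disjoint_left]
            grind
          simp only [this]
        rw [h1, h2, ← Finset.card_erase_add_one huB]
        ring
      · have hB' := (Finset.subset_insert_iff_of_notMem huB).1 hB
        have h2 : subsetExp p W
            (fun S => if A ⊆ insert u S ∧ Disjoint B (insert u S) then (1 : ℝ) else 0) =
            p ^ A.card * (1 - p) ^ B.card := by
          rw [← ih A B hAB hA' hB']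
          refine subsetExp_congr fun S hS => ?_
          simp only [h3, Finset.disjoint_insert_right, huB, not_false_eq_true, true_and]
        rw [h2, ih A B hAB hA' hB']
        ring

lemma subsetExp_subset (A : Finset α) (hA : A ⊆ W) :
    subsetExp p W (fun S => if A ⊆ S then 1 else 0) = p ^ A.card := by
  simpa using subsetExp_indicator (p := p) A ∅ (by simp) hA (by simp)

lemma subsetExp_disjoint (B : Finset α) (hB : B ⊆ W) :
    subsetExp p W (fun S => if Disjoint B S then 1 else 0) = (1 - p) ^ B.card := by
  simpa using subsetExp_indicator (p := p) ∅ B (by simp) (by simp) hB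

lemma exp_neg_le_quadratic {x : ℝ} (hx : 0 ≤ x) : Real.exp (-x) ≤ 1 - x + x ^ 2 / 2 := by
  rw [Real.exp_neg]
  have h1 := Real.quadratic_le_exp_of_nonneg hx
  refine inv_le_of_inv_le₀ (by nlinarith [sq_nonneg (x - 1)]) (le_trans ?_ h1)
  rw [inv_le_iff_one_le_mul₀ (by nlinarith [sq_nonneg (x - 1)])]
  nlinarith [sq_nonneg (x ^ 2)]

lemma two_point_exp_bound (hp0 : 0 ≤ p) {l a b c : ℝ} (hl : 0 ≤ l) (hba : b ≤ a)
    (hab : a - c ≤ b) :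
    (1 - p) * Real.exp (l * a) + p * Real.exp (l * b) ≤
      Real.exp (l * ((1 - p) * a + p * b) + p * l ^ 2 / 2 * c ^ 2) := by
  set x := l * (a - b) with hx
  have hx0 : 0 ≤ x := mul_nonneg hl (by linarith)
  have e1 : Real.exp (l * b) = Real.exp (l * a) * Real.exp (-x) := by
    rw [← Real.exp_add]; congr 1; rw [hx]; ring
  have e2 : l * ((1 - p) * a + p * b) + p * l ^ 2 / 2 * c ^ 2 =
      l * a + (-(p * x) + p * l ^ 2 / 2 * c ^ 2) := by rw [hx]; ring
  rw [e1, e2, Real.exp_add (l * a)]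
  have h1 : (1 - p) + p * Real.exp (-x) ≤ Real.exp (-(p * x) + p * l ^ 2 / 2 * c ^ 2) := by
    have h2 := exp_neg_le_quadratic hx0
    have h3 : x ^ 2 ≤ l ^ 2 * c ^ 2 := by
      rw [← mul_pow]
      exact pow_le_pow_left₀ hx0 (mul_le_mul_of_nonneg_left (by linarith) hl) 2
    have h4 := Real.add_one_le_exp (-(p * x) + p * l ^ 2 / 2 * c ^ 2)
    nlinarith [mul_le_mul_of_nonneg_left h2 hp0, mul_le_mul_of_nonneg_left h3 hp0]
  nlinarith [mul_le_mul_of_nonneg_left h1 (Real.exp_pos (l * a)).le]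

/-- An exponential moment bound for a decreasing function of a `p`-random subset with bounded
differences. -/
lemma subsetExp_exp_le_of_antitone (hp0 : 0 ≤ p) (hp1 : p ≤ 1) {l : ℝ} (hl : 0 ≤ l) (c : α → ℝ)
    (h1 : ∀ u ∈ W, ∀ S ⊆ W, u ∉ S → f (insert u S) ≤ f S)
    (h2 : ∀ u ∈ W, ∀ S ⊆ W, u ∉ S → f S - c u ≤ f (insert u S)) :
    subsetExp p W (fun S => Real.exp (l * f S)) ≤
      Real.exp (l * subsetExp p W f + p * l ^ 2 / 2 * ∑ u ∈ W, c u ^ 2) := by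
  induction W using Finset.induction_on generalizing f with
  | empty => simp [subsetExp]
  | insert u W hu ih =>
    rw [subsetExp_insert hu, subsetExp_insert hu, Finset.sum_insert hu]
    have hW : ∀ S ⊆ W, S ⊆ insert u W := fun S hS => hS.trans (Finset.subset_insert _ _)
    have huS : ∀ S ⊆ W, u ∉ S := fun S hS h => hu (hS h)
    have i1 := ih (f := f) (fun v hv S hS => h1 v (by simp [hv]) S (hW S hS))
      (fun v hv S hS => h2 v (by simp [hv]) S (hW S hS))
    have i2 := ih (f := fun S => f (insert u S))
      (fun v hv S hS hvS => by
        rw [Finset.insert_comm]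
        exact h1 v (by simp [hv]) _ (Finset.insert_subset_insert _ hS)
          (by grind))
      (fun v hv S hS hvS => by
        rw [Finset.insert_comm]
        exact h2 v (by simp [hv]) _ (Finset.insert_subset_insert _ hS)
          (by grind))
    have m1 : subsetExp p W (fun S => f (insert u S)) ≤ subsetExp p W f :=
      subsetExp_mono hp0 hp1 fun S hS => h1 u (by simp) S (hW S hS) (huS S hS)
    have m2 : subsetExp p W f - c u ≤ subsetExp p W (fun S => f (insert u S)) := by
      rw [← subsetExp_const (p := p) (W := W) (c u), ← subsetExp_sub]
      exact subsetExp_mono hp0 hp1 fun S hS => h2 u (by simp) S (hW S hS) (huS S hS)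
    have key := two_point_exp_bound hp0 hl m1 m2
    set K := p * l ^ 2 / 2 * ∑ u ∈ W, c u ^ 2 with hK
    rw [Real.exp_add] at i1 i2
    have hexp : Real.exp (l * ((1 - p) * subsetExp p W f +
        p * subsetExp p W fun S => f (insert u S)) +
        p * l ^ 2 / 2 * (c u ^ 2 + ∑ u ∈ W, c u ^ 2)) =
        Real.exp (l * ((1 - p) * subsetExp p W f +
        p * subsetExp p W fun S => f (insert u S)) + p * l ^ 2 / 2 * c u ^ 2) * Real.exp K := by
      rw [← Real.exp_add]; congr 1; rw [hK]; ring
    rw [hexp]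
    refine le_trans ?_ (mul_le_mul_of_nonneg_right key (Real.exp_pos K).le)
    nlinarith [mul_le_mul_of_nonneg_left i1 (sub_nonneg.2 hp1), mul_le_mul_of_nonneg_left i2 hp0]

lemma subsetExp_exp_card_inter_le (hp0 : 0 ≤ p) (hp1 : p ≤ 1) {l : ℝ} (hl : 0 ≤ l)
    (A : Finset α) :
    subsetExp p W (fun S => Real.exp (l * (A ∩ S).card)) ≤
      Real.exp (p * (A ∩ W).card * (Real.exp l - 1)) := by
  induction W using Finset.induction_on with
  | empty => simp [subsetExp]
  | insert u W hu ih =>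
    rw [subsetExp_insert hu]
    by_cases huA : u ∈ A
    · have h1 : subsetExp p W (fun S => Real.exp (l * (A ∩ insert u S).card)) =
          Real.exp l * subsetExp p W (fun S => Real.exp (l * (A ∩ S).card)) := by
        rw [← subsetExp_const_mul]
        refine subsetExp_congr fun S hS => ?_
        rw [Finset.inter_insert_of_mem huA, Finset.card_insert_of_notMem
          (fun h => hu (hS (Finset.mem_inter.1 h).2)), ← Real.exp_add]
        congr 1; push_cast; ring
      rw [h1, Finset.inter_insert_of_mem huA, Finset.card_insert_of_notMem
          (fun h => hu (Finset.mem_inter.1 h).2)]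
      have h2 := Real.add_one_le_exp (p * (Real.exp l - 1))
      have h3 : Real.exp (p * ((A ∩ W).card + 1 : ℕ) * (Real.exp l - 1)) =
          Real.exp (p * (Real.exp l - 1)) * Real.exp (p * (A ∩ W).card * (Real.exp l - 1)) := by
        rw [← Real.exp_add]; congr 1; push_cast; ring
      rw [h3]
      have h4 : 0 ≤ p * (Real.exp l - 1) + 1 := by
        have := Real.one_le_exp hl
        nlinarith
      calc _ = (p * (Real.exp l - 1) + 1) *
            subsetExp p W (fun S => Real.exp (l * (A ∩ S).card)) := by ring
        _ ≤ _ := mul_le_mul h2 ih ?_ (Real.exp_pos _).le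
      rw [← subsetExp_const (p := p) (W := W) 0]
      exact subsetExp_mono hp0 hp1 fun S _ => (Real.exp_pos _).le
    · simp only [Finset.inter_insert_of_notMem huA]
      linarith

/-- The Chernoff bound for the upper tail of the size of a `p`-random subset. -/
lemma subsetExp_card_inter_tail (hp0 : 0 ≤ p) (hp1 : p ≤ 1) (A : Finset α) {η μ : ℝ}
    (hη0 : 0 ≤ η) (hη1 : η ≤ 1) (hA : p * A.card ≤ μ) :
    subsetExp p W (fun S => if (1 + η) * μ < (A ∩ S).card then 1 else 0) ≤
      Real.exp (-(η ^ 2 / 4 * μ)) := by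
  have h0 := subsetExp_lt_le_exp (W := W) (f := fun S => ((A ∩ S).card : ℝ)) (t := (1 + η) * μ)
    (l := η / 2) (P := fun S => (1 + η) * μ < (A ∩ S).card) hp0 hp1 (by linarith)
    fun S _ h => h.le
  refine h0.trans ?_
  refine (mul_le_mul_of_nonneg_left (subsetExp_exp_card_inter_le hp0 hp1 (by linarith) A)
    (Real.exp_pos _).le).trans ?_
  rw [← Real.exp_add, Real.exp_le_exp]
  have h1 := Real.abs_exp_sub_one_sub_id_le (x := η / 2) (by rw [abs_le]; constructor <;> linarith)
  have h2 := (abs_le.1 h1).2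
  have h3 : ((A ∩ W).card : ℝ) ≤ A.card := by
    exact_mod_cast Finset.card_le_card Finset.inter_subset_left
  have h4 : p * (A ∩ W).card ≤ μ := (mul_le_mul_of_nonneg_left h3 hp0).trans hA
  have h5 : 0 ≤ Real.exp (η / 2) - 1 := by
    have := Real.one_le_exp (x := η / 2) (by linarith)
    linarith
  have h6 : 0 ≤ μ := le_trans (by positivity) hA
  nlinarith [mul_le_mul_of_nonneg_right h4 h5, mul_le_mul_of_nonneg_left h2 h6]

end subsetExp

/-! ### Independent sets in locally sparse graphs with small codegrees -/

section Nibble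

/-- If the sets `K a`, `a ∈ A`, have `m` elements each and small pairwise intersections, then the
number of them that avoid a `p`-random set is unlikely to be much larger than expected. -/
lemma subsetExp_card_disjoint_tail {α V : Type*} [DecidableEq α] {p γ e η δ M : ℝ} {W : Finset α}
    {K : V → Finset α} {A : Finset V} {m : ℕ} (hp0 : 0 ≤ p) (hp1 : p ≤ 1) (hγ : 0 < γ)
    (he : 0 < e) (hη : 0 ≤ η) (hKW : ∀ a ∈ A, K a ⊆ W) (hKm : ∀ a ∈ A, (K a).card = m)
    (hKδ : ∀ a ∈ A, ∀ b ∈ A, a ≠ b → ((K a ∩ K b).card : ℝ) ≤ δ) (hA : (A.card : ℝ) ≤ M)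
    (hm : p * m ≤ γ) (hδ : p * δ ≤ γ * e) (hM : 1 ≤ e * M) :
    subsetExp p W (fun S => if ((1 - p) ^ m + η) * M <
        ((A.filter fun a => Disjoint (K a) S).card : ℝ) then 1 else 0) ≤
      Real.exp (-(η ^ 2 / (4 * γ * e))) := by
  classical
  set f : Finset α → ℝ := fun S => ((A.filter fun a => Disjoint (K a) S).card : ℝ) with hf
  set c : α → ℝ := fun u => ((A.filter fun a => u ∈ K a).card : ℝ) with hc
  have hM0 : 0 < M := by
    by_contra! h
    nlinarith
  set l : ℝ := η / (2 * γ * e * M) with hl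
  have hl0 : 0 ≤ l := by positivity
  have h1 : ∀ u ∈ W, ∀ S ⊆ W, u ∉ S → f (insert u S) ≤ f S := by
    intro u _ S _ _
    simp only [hf]
    exact_mod_cast Finset.card_le_card (Finset.monotone_filter_right A fun a _ ha =>
      (Finset.disjoint_insert_right.1 ha).2)
  have h2 : ∀ u ∈ W, ∀ S ⊆ W, u ∉ S → f S - c u ≤ f (insert u S) := by
    intro u _ S _ _
    have : (A.filter fun a => Disjoint (K a) S) ⊆
        (A.filter fun a => Disjoint (K a) (insert u S)) ∪ (A.filter fun a => u ∈ K a) := by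
      intro a ha
      simp only [Finset.mem_union, Finset.mem_filter, Finset.disjoint_insert_right] at ha ⊢
      tauto
    have h3 := (Finset.card_le_card this).trans (Finset.card_union_le _ _)
    have h4 : f S ≤ f (insert u S) + c u := by
      simp only [hf, hc]
      exact_mod_cast h3
    linarith
  have hexp : subsetExp p W f = A.card * (1 - p) ^ m := by
    have : f = fun S => ∑ a ∈ A, if Disjoint (K a) S then (1 : ℝ) else 0 := by
      funext S
      simp [hf]
    rw [this, subsetExp_sum, Finset.sum_congr rfl fun a ha => by
      rw [subsetExp_disjoint _ (hKW a ha), hKm a ha]]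
    simp
  have hsum : ∑ u ∈ W, c u ^ 2 = ∑ a ∈ A, ∑ b ∈ A, ((K a ∩ K b).card : ℝ) := by
    have e1 : ∀ u, c u ^ 2 =
        ∑ a ∈ A, ∑ b ∈ A, if u ∈ K a ∩ K b then (1 : ℝ) else 0 := by
      intro u
      have : c u = ∑ a ∈ A, if u ∈ K a then (1 : ℝ) else 0 := by simp [hc]
      rw [this, sq, Finset.sum_mul_sum]
      refine Finset.sum_congr rfl fun a _ => Finset.sum_congr rfl fun b _ => ?_
      by_cases ha : u ∈ K a <;> by_cases hb : u ∈ K b <;> simp [ha, hb]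
    rw [Finset.sum_congr rfl fun u _ => e1 u, Finset.sum_comm]
    refine Finset.sum_congr rfl fun a ha => ?_
    rw [Finset.sum_comm]
    refine Finset.sum_congr rfl fun b _ => ?_
    have : W.filter (fun u => u ∈ K a ∩ K b) = K a ∩ K b := by
      rw [Finset.filter_mem_eq_inter]
      exact Finset.inter_eq_right.2 (Finset.inter_subset_left.trans (hKW a ha))
    rw [Finset.sum_boole, this]
  have hQ : p * ∑ u ∈ W, c u ^ 2 ≤ 2 * γ * e * M ^ 2 := by
    have e1 : ∀ a ∈ A, p * ∑ b ∈ A, ((K a ∩ K b).card : ℝ) ≤ γ + γ * e * M := by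
      intro a ha
      rw [← Finset.add_sum_erase _ _ ha, Finset.inter_self, hKm a ha, mul_add]
      refine add_le_add hm ?_
      rw [Finset.mul_sum]
      have e2 : ∀ b ∈ A.erase a, p * ((K a ∩ K b).card : ℝ) ≤ γ * e := fun b hb =>
        (mul_le_mul_of_nonneg_left (hKδ a ha b (Finset.mem_of_mem_erase hb)
          (Finset.ne_of_mem_erase hb).symm) hp0).trans hδ
      have e3 := Finset.sum_le_card_nsmul _ _ _ e2
      rw [nsmul_eq_mul] at e3
      refine e3.trans ?_
      have e4 : ((A.erase a).card : ℝ) ≤ M :=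
        le_trans (by exact_mod_cast Finset.card_le_card (Finset.erase_subset _ _)) hA
      rw [mul_comm]
      exact mul_le_mul_of_nonneg_left e4 (by positivity)
    rw [hsum, Finset.mul_sum]
    refine (Finset.sum_le_card_nsmul _ _ _ e1).trans ?_
    rw [nsmul_eq_mul]
    have e5 : (A.card : ℝ) * (γ + γ * e * M) ≤ M * (γ + γ * e * M) :=
      mul_le_mul_of_nonneg_right hA (by positivity)
    have e6 : γ * M * 1 ≤ γ * M * (e * M) := mul_le_mul_of_nonneg_left hM (by positivity)
    nlinarith
  refine (subsetExp_lt_le_exp (f := f) (t := ((1 - p) ^ m + η) * M) (l := l) hp0 hp1 hl0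
    fun S _ h => h.le).trans ?_
  refine (mul_le_mul_of_nonneg_left (subsetExp_exp_le_of_antitone hp0 hp1 hl0 c h1 h2)
    (Real.exp_pos _).le).trans ?_
  rw [← Real.exp_add, Real.exp_le_exp, hexp]
  have h5 : l * (A.card * (1 - p) ^ m) ≤ l * (M * (1 - p) ^ m) :=
    mul_le_mul_of_nonneg_left (mul_le_mul_of_nonneg_right hA
      (pow_nonneg (sub_nonneg.2 hp1) m)) hl0
  have h6 : p * l ^ 2 / 2 * ∑ u ∈ W, c u ^ 2 ≤ l ^ 2 / 2 * (2 * γ * e * M ^ 2) := by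
    have := mul_le_mul_of_nonneg_left hQ (show 0 ≤ l ^ 2 / 2 by positivity)
    linarith
  have h7 : l ^ 2 / 2 * (2 * γ * e * M ^ 2) = η ^ 2 / (4 * γ * e) := by
    rw [hl]; field_simp; ring
  have h8 : l * (η * M) = 2 * (η ^ 2 / (4 * γ * e)) := by
    rw [hl]; field_simp; ring
  linarith

variable {V : Type*} {r : V → V → Prop}

open scoped Classical in
/-- Every closed neighbourhood of the relation `r` on `X` has at most `D` elements, and two distinct
ones share at most `δ` elements. -/
def ClosedNbhdBound (r : V → V → Prop) (X : Finset V) (D δ : ℝ) : Prop :=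
  (∀ v ∈ X, ((X.filter (r v)).card : ℝ) ≤ D) ∧
    ∀ v ∈ X, ∀ w ∈ X, v ≠ w → ((X.filter fun z => r v z ∧ r w z).card : ℝ) ≤ δ

open scoped Classical in
/-- One step of the semi-random method: a random sparse set of vertices is selected, and their
neighbours are discarded together with the vertices around which the degrees do not decrease
proportionally. -/
lemma exists_nibble (hrefl : ∀ v, r v v) (hsymm : ∀ v w, r v w → r w v) {X : Finset V}
    {D γ e η c : ℝ} (he : 0 < e) (he1 : e ≤ 1) (hD : 1 ≤ e * (e * D)) (hγ : 0 < γ) (hγ1 : γ ≤ 1)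
    (hη : 0 ≤ η) (hc : 0 ≤ c) (hX : ClosedNbhdBound r X D (e * D)) :
    ∃ I ⊆ X, ∃ Y ⊆ X, (∀ v ∈ I, ∀ w ∈ I, v ≠ w → ¬ r v w) ∧ (∀ v ∈ I, ∀ w ∈ Y, ¬ r v w) ∧
      ClosedNbhdBound r Y (((1 - γ / D) ^ ⌊D⌋₊ + η) * D) (((1 - γ / D) ^ ⌊D⌋₊ + η) * (e * D)) ∧
      X.card * (γ / D * (1 - γ / D) ^ ⌊D⌋₊ + c * ((1 - γ / D) ^ ⌊D⌋₊ -
        (1 + D ^ 2) * Real.exp (-(η ^ 2 / (4 * γ * e))))) ≤ I.card + c * Y.card := by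
  have hD0 : 0 < D := by
    by_contra! h
    have : e * D ≤ 0 := mul_nonpos_of_nonneg_of_nonpos he.le h
    nlinarith
  have heD : 1 ≤ e * D := by nlinarith [mul_pos he hD0]
  have hD1 : 1 ≤ D := by nlinarith
  set p : ℝ := γ / D with hp
  set m : ℕ := ⌊D⌋₊ with hm
  have hmD : (m : ℝ) ≤ D := Nat.floor_le hD0.le
  have hp0 : 0 ≤ p := by positivity
  have hp1 : p ≤ 1 := (div_le_one hD0).2 (hγ1.trans hD1)
  have hpD : p * D = γ := by rw [hp]; field_simp
  set σ : ℝ := (1 - p) ^ m with hσ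
  set ρ : ℝ := σ + η with hρ
  set N : V → Finset V := fun v => X.filter (r v) with hN
  have hNm : ∀ v ∈ X, (N v).card ≤ m := fun v hv => Nat.le_floor (hX.1 v hv)
  set W : Finset (V ⊕ (V × ℕ)) := X.disjSum (X ×ˢ Finset.range m) with hW
  set K : V → Finset (V ⊕ (V × ℕ)) := fun v =>
    (N v).disjSum ({v} ×ˢ Finset.range (m - (N v).card)) with hK
  have hKW : ∀ v ∈ X, K v ⊆ W := by
    intro v hv
    refine Finset.disjSum_mono (Finset.filter_subset _ _) (Finset.product_subset_product ?_ ?_)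
    · simpa using hv
    · exact Finset.range_subset_range.2 (Nat.sub_le _ _)
  have hKm : ∀ v ∈ X, (K v).card = m := by
    intro v hv
    rw [hK, Finset.card_disjSum, Finset.card_product, Finset.card_singleton, Finset.card_range,
      one_mul, Nat.add_sub_cancel' (hNm v hv)]
  have hKδ : ∀ v ∈ X, ∀ w ∈ X, v ≠ w → ((K v ∩ K w).card : ℝ) ≤ e * D := by
    intro v hv w hw hvw
    refine le_trans ?_ (hX.2 v hv w hw hvw)
    have : K v ∩ K w ⊆ (X.filter fun z => r v z ∧ r w z).map Function.Embedding.inl := by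
      intro z hz
      rcases z with z | ⟨a, i⟩
      · simp only [hK, hN, Finset.mem_inter, Finset.inl_mem_disjSum, Finset.mem_filter,
          Finset.mem_map, Function.Embedding.inl_apply, Sum.inl.injEq, exists_eq_right] at hz ⊢
        tauto
      · simp only [hK, Finset.mem_inter, Finset.inr_mem_disjSum, Finset.mem_product,
          Finset.mem_singleton] at hz
        exact absurd (hz.1.1.symm.trans hz.2.1) hvw
    have h2 := Finset.card_le_card this
    rw [Finset.card_map] at h2
    exact_mod_cast h2
  -- the random sets
  set I : Finset (V ⊕ (V × ℕ)) → Finset V := fun S => X.filter fun v =>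
    Sum.inl v ∈ S ∧ ∀ w ∈ X, w ≠ v → r v w → Sum.inl w ∉ S with hI
  set B : V → Finset V := fun v => (X.filter fun w => w ≠ v ∧ ∃ z ∈ X, r v z ∧ r w z) with hB
  set surv : Finset (V ⊕ (V × ℕ)) → Finset V → Finset V := fun S A =>
    A.filter fun a => Disjoint (K a) S with hsurv
  set cn : V → V → Finset V := fun v w => X.filter fun z => r v z ∧ r w z with hcn
  set Y : Finset (V ⊕ (V × ℕ)) → Finset V := fun S => X.filter fun v =>
    Disjoint (K v) S ∧ ¬ (ρ * D < ((surv S (N v)).card : ℝ)) ∧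
      ∀ w ∈ B v, ¬ (ρ * (e * D) < ((surv S (cn v w)).card : ℝ)) with hY
  set τ : ℝ := Real.exp (-(η ^ 2 / (4 * γ * e))) with hτ
  have hBcard : ∀ v ∈ X, ((B v).card : ℝ) ≤ D ^ 2 := by
    intro v hv
    have h1 : B v ⊆ (N v).biUnion N := by
      intro w hw
      simp only [hB, hN, Finset.mem_filter, Finset.mem_biUnion] at hw ⊢
      obtain ⟨hw, -, z, hz, hvz, hwz⟩ := hw
      exact ⟨z, ⟨hz, hvz⟩, hw, hsymm _ _ hwz⟩
    have h2 : (B v).card ≤ (N v).card * m := (Finset.card_le_card h1).trans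
      (Finset.card_biUnion_le_card_mul _ _ _ fun a ha => hNm a (Finset.mem_filter.1 ha).1)
    have h3 : (B v).card ≤ m * m := h2.trans (Nat.mul_le_mul_right m (hNm v hv))
    have h4 : ((B v).card : ℝ) ≤ m * m := by exact_mod_cast h3
    nlinarith [Nat.cast_nonneg (α := ℝ) m]
  have tail : ∀ A : Finset V, ∀ M : ℝ, A ⊆ X → (A.card : ℝ) ≤ M → 1 ≤ e * M →
      subsetExp p W (fun S => if ρ * M < ((surv S A).card : ℝ) then 1 else 0) ≤ τ := by
    intro A M hA hAM hM
    refine subsetExp_card_disjoint_tail hp0 hp1 hγ he hη (fun a ha => hKW a (hA ha))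
      (fun a ha => hKm a (hA ha)) (fun a ha b hb => hKδ a (hA ha) b (hA hb)) hAM ?_ ?_ hM
    · rw [← hpD]; exact mul_le_mul_of_nonneg_left hmD hp0
    · rw [← hpD]; exact le_of_eq (by ring)
  have hIexp : X.card * (p * σ) ≤ subsetExp p W (fun S => ((I S).card : ℝ)) := by
    have e1 : ∀ v ∈ X, p * σ ≤ subsetExp p W (fun S => if v ∈ I S then 1 else 0) := by
      intro v hv
      have hvK : (Sum.inl v : V ⊕ (V × ℕ)) ∈ K v := by
        simp [hK, hN, hv, hrefl]
      have e2 := subsetExp_indicator (p := p) {Sum.inl v} ((K v).erase (Sum.inl v))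
        (by simp) (by simpa using hKW v hv hvK) ((Finset.erase_subset _ _).trans (hKW v hv))
      have e3 : p * σ ≤ p ^ Finset.card {(Sum.inl v : V ⊕ (V × ℕ))} *
          (1 - p) ^ ((K v).erase (Sum.inl v)).card := by
        rw [Finset.card_singleton, pow_one]
        refine mul_le_mul_of_nonneg_left ?_ hp0
        refine pow_le_pow_of_le_one (sub_nonneg.2 hp1) (by linarith) ?_
        rw [← hKm v hv]
        exact Finset.card_le_card (Finset.erase_subset _ _)
      rw [← e2] at e3
      refine e3.trans (subsetExp_mono hp0 hp1 fun S hS => ?_)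
      split_ifs with h1 h2 h2
      · exact le_rfl
      · refine absurd ?_ h2
        simp only [hI, Finset.mem_filter]
        refine ⟨hv, by simpa using h1.1, fun w hw hwv hvw hwS => ?_⟩
        refine Finset.disjoint_left.1 h1.2 ?_ hwS
        simp [hK, hN, hw, hvw, hwv]
      · exact zero_le_one
      · exact le_rfl
    have e4 : (fun S => ((I S).card : ℝ)) = fun S => ∑ v ∈ X, if v ∈ I S then (1 : ℝ) else 0 := by
      funext S
      rw [Finset.sum_boole, Finset.filter_mem_eq_inter,
        Finset.inter_eq_right.2 (Finset.filter_subset _ _)]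
    rw [e4, subsetExp_sum, ← nsmul_eq_mul]
    exact Finset.card_nsmul_le_sum _ _ _ e1
  have hYexp : X.card * (σ - (1 + D ^ 2) * τ) ≤ subsetExp p W (fun S => ((Y S).card : ℝ)) := by
    have e1 : ∀ v ∈ X, σ - (1 + D ^ 2) * τ ≤
        subsetExp p W (fun S => if v ∈ Y S then 1 else 0) := by
      intro v hv
      have e2 : subsetExp p W (fun S => ((if Disjoint (K v) S then (1 : ℝ) else 0) -
          (if ρ * D < ((surv S (N v)).card : ℝ) then 1 else 0)) -
          ∑ w ∈ B v, if ρ * (e * D) < ((surv S (cn v w)).card : ℝ) then 1 else 0) ≤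
          subsetExp p W (fun S => if v ∈ Y S then 1 else 0) := by
        refine subsetExp_mono hp0 hp1 fun S hS => ?_
        have e3 : ∀ w ∈ B v, (0 : ℝ) ≤
            if ρ * (e * D) < ((surv S (cn v w)).card : ℝ) then 1 else 0 := by
          intro w _; split_ifs <;> norm_num
        have e4 := Finset.sum_nonneg e3
        by_cases h1 : Disjoint (K v) S
        · by_cases h2 : ρ * D < ((surv S (N v)).card : ℝ)
          · simp only [h1, h2, if_true]
            split_ifs <;> linarith
          · by_cases h3 : ∀ w ∈ B v, ¬ (ρ * (e * D) < ((surv S (cn v w)).card : ℝ))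
            · have : v ∈ Y S := Finset.mem_filter.2 ⟨hv, h1, h2, h3⟩
              simp only [h1, h2, this, if_true, if_false]
              linarith
            · push Not at h3
              obtain ⟨w, hw, h3⟩ := h3
              have e5 := Finset.single_le_sum e3 hw
              simp only [h3, if_true] at e5
              simp only [h1, h2, if_true, if_false]
              split_ifs <;> linarith
        · simp only [h1, if_false]
          split_ifs <;> linarith
      rw [subsetExp_sub, subsetExp_sub, subsetExp_sum, subsetExp_disjoint _ (hKW v hv),
        hKm v hv] at e2
      have e6 := tail (N v) D (Finset.filter_subset _ _) (hX.1 v hv) heD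
      have e7 : ∀ w ∈ B v, subsetExp p W
          (fun S => if ρ * (e * D) < ((surv S (cn v w)).card : ℝ) then 1 else 0) ≤ τ := by
        intro w hw
        simp only [hB, Finset.mem_filter] at hw
        exact tail (cn v w) (e * D) (Finset.filter_subset _ _) (hX.2 v hv w hw.1 hw.2.1.symm) hD
      have e8 := Finset.sum_le_card_nsmul _ _ _ e7
      rw [nsmul_eq_mul] at e8
      have e9 := mul_le_mul_of_nonneg_right (hBcard v hv) (Real.exp_pos (-(η ^ 2 / (4 * γ * e)))).le
      rw [← hτ] at e9
      linarith
    have e4 : (fun S => ((Y S).card : ℝ)) = fun S => ∑ v ∈ X, if v ∈ Y S then (1 : ℝ) else 0 := by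
      funext S
      rw [Finset.sum_boole, Finset.filter_mem_eq_inter,
        Finset.inter_eq_right.2 (Finset.filter_subset _ _)]
    rw [e4, subsetExp_sum, ← nsmul_eq_mul]
    exact Finset.card_nsmul_le_sum _ _ _ e1
  have htot : X.card * (p * σ + c * (σ - (1 + D ^ 2) * τ)) ≤
      subsetExp p W (fun S => ((I S).card : ℝ) + c * ((Y S).card : ℝ)) := by
    rw [subsetExp_add, subsetExp_const_mul]
    have := mul_le_mul_of_nonneg_left hYexp hc
    linarith
  obtain ⟨S, -, hS⟩ := exists_le_of_le_subsetExp hp0 hp1 htot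
  refine ⟨I S, Finset.filter_subset _ _, Y S, Finset.filter_subset _ _, ?_, ?_, ⟨?_, ?_⟩, hS⟩
  · intro v hv w hw hvw h
    simp only [hI, Finset.mem_filter] at hv hw
    exact hv.2.2 w hw.1 hvw.symm h hw.2.1
  · intro v hv w hw h
    simp only [hI, hY, Finset.mem_filter] at hv hw
    refine Finset.disjoint_left.1 hw.2.1 ?_ hv.2.1
    simp [hK, hN, hv.1, hsymm _ _ h]
  · intro v hv
    simp only [hY, Finset.mem_filter] at hv
    refine le_trans ?_ (not_lt.1 hv.2.2.1)
    have : (Y S).filter (r v) ⊆ surv S (N v) := by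
      intro z hz
      simp only [hY, hsurv, hN, Finset.mem_filter] at hz ⊢
      tauto
    exact_mod_cast Finset.card_le_card this
  · intro v hv w hw hvw
    have hw' := (Finset.mem_filter.1 hw).1
    simp only [hY, Finset.mem_filter] at hv
    by_cases hwB : w ∈ B v
    · refine le_trans ?_ (not_lt.1 (hv.2.2.2 w hwB))
      have : ((Y S).filter fun z => r v z ∧ r w z) ⊆ surv S (cn v w) := by
        intro z hz
        simp only [hY, hsurv, hcn, Finset.mem_filter] at hz ⊢
        tauto
      exact_mod_cast Finset.card_le_card this
    · have : ((Y S).filter fun z => r v z ∧ r w z) = ∅ := by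
        refine Finset.filter_eq_empty_iff.2 fun z hz h => hwB ?_
        exact Finset.mem_filter.2 ⟨hw', hvw.symm, z, (Finset.mem_filter.1 hz).1, h⟩
      rw [this]
      have : 0 ≤ ρ := add_nonneg (pow_nonneg (sub_nonneg.2 hp1) m) hη
      simp only [Finset.card_empty, Nat.cast_zero]
      positivity

end Nibble

section IndependentSets

variable {V : Type*} {r : V → V → Prop}

lemma one_sub_div_pow_floor_bounds {γ D : ℝ} (hγ : 0 < γ) (hγ1 : γ ≤ 1 / 2) (hD : 1 ≤ D) :
    1 - γ ≤ (1 - γ / D) ^ ⌊D⌋₊ ∧ (1 - γ / D) ^ ⌊D⌋₊ ≤ 1 - γ / 4 ∧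
      -(γ / (1 - γ)) ≤ Real.log ((1 - γ / D) ^ ⌊D⌋₊) := by
  have hD0 : 0 < D := by linarith
  have hm : (⌊D⌋₊ : ℝ) ≤ D := Nat.floor_le hD0.le
  have hp0 : 0 ≤ γ / D := by positivity
  have hpγ : γ / D ≤ γ := div_le_self hγ.le hD
  have hmp : ⌊D⌋₊ * (γ / D) ≤ γ := by
    calc (⌊D⌋₊ : ℝ) * (γ / D) ≤ D * (γ / D) := mul_le_mul_of_nonneg_right hm hp0
      _ = γ := by field_simp
  have hmp2 : γ / 2 ≤ ⌊D⌋₊ * (γ / D) := by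
    have h1 : D < ⌊D⌋₊ + 1 := Nat.lt_floor_add_one D
    have h2 : (1 : ℝ) ≤ ⌊D⌋₊ := by exact_mod_cast Nat.le_floor (by simpa using hD)
    calc γ / 2 = D / 2 * (γ / D) := by field_simp
      _ ≤ _ := mul_le_mul_of_nonneg_right (by linarith) hp0
  refine ⟨?_, ?_, ?_⟩
  · have := one_add_mul_le_pow (a := -(γ / D)) (by linarith) ⌊D⌋₊
    rw [← sub_eq_add_neg] at this
    linarith
  · have h1 : 1 - γ / D ≤ Real.exp (-(γ / D)) := by
      have := Real.add_one_le_exp (-(γ / D)); linarith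
    have h2 := pow_le_pow_left₀ (by linarith) h1 ⌊D⌋₊
    rw [← Real.exp_nat_mul] at h2
    have h3 : Real.exp (⌊D⌋₊ * -(γ / D)) ≤ Real.exp (-(γ / 2)) := Real.exp_le_exp.2 (by linarith)
    have h4 := exp_neg_le_quadratic (x := γ / 2) (by linarith)
    nlinarith
  · rw [Real.log_pow]
    have h1 : -(γ / D / (1 - γ / D)) ≤ Real.log (1 - γ / D) := by
      have h2 := Real.one_sub_inv_le_log_of_pos (x := 1 - γ / D) (by linarith)
      refine le_trans (le_of_eq ?_) h2
      have : 1 - γ / D ≠ 0 := by linarith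
      rw [eq_sub_iff_add_eq, inv_eq_one_div, ← neg_div, ← add_div, div_eq_one_iff_eq this]
      ring
    have h3 := mul_le_mul_of_nonneg_left h1 (Nat.cast_nonneg (α := ℝ) ⌊D⌋₊)
    refine le_trans ?_ h3
    have h4 : ⌊D⌋₊ * (γ / D / (1 - γ / D)) ≤ γ / (1 - γ) := by
      rw [← mul_div_assoc]
      exact div_le_div₀ hγ.le hmp (by linarith) (by linarith)
    linarith

lemma nibble_gain_bound {γ σ η β L Λ : ℝ} (hγ : 0 < γ) (hγ1 : γ ≤ 1 / 2) (hσ : 1 - γ ≤ σ)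
    (hη : 0 ≤ η) (hβ : 0 ≤ β) (hρ : σ + η ≤ 1) (hlog : -(γ / (1 - γ)) ≤ Real.log σ)
    (hL : L ≤ Λ) (hΛ : Λ * (η + β) ≤ γ ^ 2) (hL0 : 0 ≤ L) :
    (1 - γ) ^ 3 * L ≤
      γ * σ + (1 - γ) ^ 3 * max (L + Real.log (σ + η)) 0 / (σ + η) * (σ - β) := by
  set ρ := σ + η with hρd
  set κ := (1 - γ) ^ 3 with hκ
  have h1γ : 0 < 1 - γ := by linarith
  have hκ0 : 0 < κ := by positivity
  have hρ0 : 0 < ρ := by linarith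
  have hlρ : Real.log σ ≤ Real.log ρ := Real.log_le_log (by linarith) (by linarith)
  have hlρ0 : Real.log ρ ≤ 0 := Real.log_nonpos hρ0.le hρ
  set l := max (L + Real.log ρ) 0 with hl
  have hl0 : 0 ≤ l := le_max_right _ _
  have hlL : l ≤ L := max_le (by linarith) hL0
  have hlΛ : l * (η + β) ≤ γ ^ 2 := by nlinarith [add_nonneg hη hβ]
  have e1 : κ * l / ρ * (σ - β) = κ * l - κ * (l * (η + β)) / ρ := by
    field_simp
    rw [hρd]; ring
  have e2 : κ * (l * (η + β)) / ρ ≤ κ * γ ^ 2 / (1 - γ) :=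
    div_le_div₀ (by positivity) (mul_le_mul_of_nonneg_left hlΛ hκ0.le) h1γ (by linarith)
  have e3 : κ * (L - γ / (1 - γ)) ≤ κ * l :=
    mul_le_mul_of_nonneg_left (le_trans (by linarith) (le_max_left _ _)) hκ0.le
  have e4 : κ * (γ / (1 - γ)) = (1 - γ) ^ 2 * γ := by rw [hκ]; field_simp
  have e5 : κ * γ ^ 2 / (1 - γ) = (1 - γ) ^ 2 * γ ^ 2 := by rw [hκ]; field_simp
  have e6 : γ * (1 - γ) ≤ γ * σ := mul_le_mul_of_nonneg_left hσ hγ.le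
  have e7 : 0 ≤ γ * (1 - γ) * γ ^ 2 := by positivity
  rw [e1]
  nlinarith

lemma exists_indep_aux (hrefl : ∀ v, r v v) (hsymm : ∀ v w, r v w → r w v) {γ e Λ : ℝ}
    (hγ : 0 < γ) (hγ1 : γ ≤ 1 / 2) (he : 0 < e) (he1 : e ≤ 1) (hΛ : 2 ≤ Λ)
    (hΛe : 64 * Λ ^ 3 * e ≤ γ ^ 3) (hΛγ : 4 * Λ ≤ γ ^ 2 * Real.exp (2 * Λ)) (k : ℕ) :
    ∀ (D : ℝ) (X : Finset V), 0 < D → Real.log D ≤ Λ → e ^ 2 * D * (1 - γ / 8) ^ k ≤ 1 →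
      ClosedNbhdBound r X D (e * D) → ∃ I ⊆ X, (∀ v ∈ I, ∀ w ∈ I, v ≠ w → ¬ r v w) ∧
        (1 - γ) ^ 3 * (X.card / D) * (Real.log D + 2 * Real.log e) ≤ I.card := by
  classical
  have triv : ∀ (D : ℝ) (X : Finset V), 0 < D → e ^ 2 * D ≤ 1 →
      ∃ I ⊆ X, (∀ v ∈ I, ∀ w ∈ I, v ≠ w → ¬ r v w) ∧
        (1 - γ) ^ 3 * (X.card / D) * (Real.log D + 2 * Real.log e) ≤ I.card := by
    intro D X hD h
    refine ⟨∅, by simp, by simp, ?_⟩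
    have h1 := Real.log_nonpos (by positivity) h
    rw [Real.log_mul (by positivity) hD.ne', Real.log_pow] at h1
    push_cast at h1
    have : 0 ≤ (1 - γ) ^ 3 * (X.card / D) := by
      have : 0 ≤ 1 - γ := by linarith
      positivity
    simp only [Finset.card_empty, Nat.cast_zero]
    exact mul_nonpos_of_nonneg_of_nonpos this (by linarith)
  induction k with
  | zero => exact fun D X hD _ h _ => triv D X hD (by simpa using h)
  | succ k ih =>
    intro D X hD0 hDΛ hk hX
    by_cases hD : e ^ 2 * D ≤ 1
    · exact triv D X hD0 hD
    push Not at hD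
    have hD1 : 1 ≤ D := by
      have : e ^ 2 ≤ 1 := pow_le_one₀ he.le he1
      nlinarith
    obtain ⟨hσ1, hσ2, hσ3⟩ := one_sub_div_pow_floor_bounds hγ hγ1 hD1
    set σ := (1 - γ / D) ^ ⌊D⌋₊ with hσ
    have hΛ0 : 0 < Λ := by linarith
    set η := γ ^ 2 / (2 * Λ) with hη
    have hη0 : 0 ≤ η := by positivity
    have hη1 : η ≤ γ / 8 := by
      rw [hη, div_le_div_iff₀ (by positivity) (by norm_num)]
      nlinarith [mul_le_mul_of_nonneg_left hΛ hγ.le]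
    set β := (1 + D ^ 2) * Real.exp (-(η ^ 2 / (4 * γ * e))) with hβ
    have hβ0 : 0 ≤ β := by positivity
    have hβ1 : β ≤ γ ^ 2 / (2 * Λ) := by
      have h1 : 4 * Λ ≤ η ^ 2 / (4 * γ * e) := by
        have : η ^ 2 / (4 * γ * e) = γ ^ 3 / (16 * Λ ^ 2 * e) := by
          rw [hη]; field_simp; ring
        rw [this, le_div_iff₀ (by positivity)]
        linarith
      have h2 : D ≤ Real.exp Λ := (Real.log_le_iff_le_exp hD0).1 hDΛ
      have h3 : 1 + D ^ 2 ≤ 2 * Real.exp (2 * Λ) := by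
        have : Real.exp (2 * Λ) = Real.exp Λ ^ 2 := by
          rw [← Real.exp_nat_mul]; norm_num
        rw [this]
        nlinarith
      have h4 : β ≤ 2 * Real.exp (2 * Λ) * Real.exp (-(4 * Λ)) :=
        mul_le_mul h3 (Real.exp_le_exp.2 (by linarith)) (Real.exp_pos _).le (by positivity)
      have h5 : 2 * Real.exp (2 * Λ) * Real.exp (-(4 * Λ)) = 2 / Real.exp (2 * Λ) := by
        rw [mul_assoc, ← Real.exp_add, div_eq_mul_inv, ← Real.exp_neg]
        congr 2; ring
      rw [h5] at h4
      refine h4.trans ?_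
      rw [div_le_div_iff₀ (Real.exp_pos _) (by positivity)]
      linarith
    set ρ := σ + η with hρ
    have hρ0 : 0 < ρ := by linarith
    have hρ1 : ρ ≤ 1 - γ / 8 := by linarith
    set L := Real.log D + 2 * Real.log e with hL
    have hL0 : 0 ≤ L := by
      have h1 := Real.log_nonneg hD.le
      rw [Real.log_mul (by positivity) hD0.ne', Real.log_pow] at h1
      push_cast at h1
      linarith
    have hLΛ : L ≤ Λ := by linarith [Real.log_nonpos he.le he1]
    have hgain := nibble_gain_bound (β := β) (Λ := Λ) hγ hγ1 hσ1 hη0 hβ0 (by linarith) hσ3 hLΛ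
      (by
        have h1 : Λ * (η + β) ≤ Λ * (γ ^ 2 / (2 * Λ) + γ ^ 2 / (2 * Λ)) :=
          mul_le_mul_of_nonneg_left (by linarith) hΛ0.le
        refine h1.trans (le_of_eq ?_)
        field_simp; ring) hL0
    rw [← hρ] at hgain
    set l := max (L + Real.log ρ) 0 with hl
    have hl0 : 0 ≤ l := le_max_right _ _
    have h1γ : 0 < 1 - γ := by linarith
    obtain ⟨I, hIX, Y, hYX, hI, hIY, hYbd, hcard⟩ :=
      exists_nibble (η := η) (c := (1 - γ) ^ 3 * l / (ρ * D)) hrefl hsymm he he1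
        (by nlinarith) hγ (by linarith) hη0 (by positivity) hX
    rw [← hσ, ← hβ] at hcard
    rw [← hσ, ← hρ] at hYbd
    obtain ⟨J, hJY, hJ, hJcard⟩ := ih (ρ * D) Y (by positivity)
      (by
        rw [Real.log_mul hρ0.ne' hD0.ne']
        linarith [Real.log_nonpos hρ0.le (by linarith)])
      (by
        refine le_trans ?_ hk
        have h1 : 0 ≤ (1 - γ / 8) ^ k := pow_nonneg (by linarith) k
        rw [pow_succ]
        have h2 : 0 ≤ e ^ 2 * D * (1 - γ / 8) ^ k := by positivity
        calc e ^ 2 * (ρ * D) * (1 - γ / 8) ^ k = e ^ 2 * D * (1 - γ / 8) ^ k * ρ := by ring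
          _ ≤ e ^ 2 * D * (1 - γ / 8) ^ k * (1 - γ / 8) := mul_le_mul_of_nonneg_left hρ1 h2
          _ = e ^ 2 * D * ((1 - γ / 8) ^ k * (1 - γ / 8)) := by ring)
      (by convert hYbd using 1; ring)
    have hJcard' : (1 - γ) ^ 3 * l / (ρ * D) * Y.card ≤ J.card := by
      rcases max_cases (L + Real.log ρ) 0 with h | h
      · have h1 : Real.log (ρ * D) + 2 * Real.log e = l := by
          rw [Real.log_mul hρ0.ne' hD0.ne', hl, h.1, hL]
          ring
        rw [h1] at hJcard
        refine le_trans (le_of_eq ?_) hJcard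
        ring
      · rw [hl, h.1]
        simp
    have hdisj : Disjoint I J := Finset.disjoint_left.2 fun v hv hvJ =>
      hIY v hv v (hJY hvJ) (hrefl v)
    refine ⟨I ∪ J, Finset.union_subset hIX (hJY.trans hYX), ?_, ?_⟩
    · intro v hv w hw hvw
      rcases Finset.mem_union.1 hv with hv | hv <;> rcases Finset.mem_union.1 hw with hw | hw
      · exact hI v hv w hw hvw
      · exact hIY v hv w (hJY hw)
      · exact fun h => hIY w hw v (hJY hv) (hsymm _ _ h)
      · exact hJ v hv w hw hvw
    · rw [Finset.card_union_of_disjoint hdisj]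
      push_cast
      have h1 : (X.card : ℝ) * (γ / D * σ + (1 - γ) ^ 3 * l / (ρ * D) * (σ - β)) =
          X.card / D * (γ * σ + (1 - γ) ^ 3 * l / ρ * (σ - β)) := by
        field_simp
      have h2 := mul_le_mul_of_nonneg_left hgain (show 0 ≤ (X.card : ℝ) / D by positivity)
      linarith

/-- A graph with degrees at most about `D` and codegrees at most `e * D`, where `e` is small
compared to a power of `log D`, has an independent set of about `(|X| / D) * log D` vertices. -/
theorem exists_indep_of_closedNbhdBound (hrefl : ∀ v, r v v) (hsymm : ∀ v w, r v w → r w v)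
    {γ e D : ℝ} (hγ : 0 < γ) (hγ1 : γ ≤ 1 / 2) (he : 0 < e) (he1 : e ≤ 1) (hD0 : 0 < D)
    (hD : 2 ≤ Real.log D) (hDe : 64 * Real.log D ^ 3 * e ≤ γ ^ 3)
    (hDγ : 4 * Real.log D ≤ γ ^ 2 * D ^ 2) {X : Finset V} (hX : ClosedNbhdBound r X D (e * D)) :
    ∃ I ⊆ X, (∀ v ∈ I, ∀ w ∈ I, v ≠ w → ¬ r v w) ∧
      (1 - γ) ^ 3 * (X.card / D) * (Real.log D + 2 * Real.log e) ≤ I.card := by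
  obtain ⟨k, hk⟩ := exists_pow_lt_of_lt_one (show 0 < 1 / (e ^ 2 * D) by positivity)
    (show 1 - γ / 8 < 1 by linarith)
  refine exists_indep_aux hrefl hsymm hγ hγ1 he he1 hD hDe ?_ k D X hD0 le_rfl ?_ hX
  · have : Real.exp (2 * Real.log D) = D ^ 2 := by
      rw [mul_comm, Real.exp_mul, Real.exp_log hD0]; norm_num
    rwa [this]
  · rw [lt_div_iff₀ (by positivity)] at hk
    linarith

end IndependentSets

section Sparsification

open scoped Classical in
/-- A random sparse subset of `Y`, after deleting few elements, has no pair of distinct elements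
related by `cl`, and its `r`-degrees and `r`-codegrees are at most what is expected. -/
lemma exists_sparse_closedNbhdBound {V : Type*} {r cl : V → V → Prop}
    (hsymm : ∀ v w, r v w → r w v) {Y : Finset V} {N N' N'' γ μ e : ℝ} (hγ : 0 < γ) (hγ1 : γ ≤ 1)
    (hμ : 0 < μ) (hμN : μ ≤ N) (he : 0 < e)
    (hN : ∀ x ∈ Y, ((Y.filter (r x)).card : ℝ) ≤ N)
    (hN' : ∀ x ∈ Y, ((Y.filter (cl x)).card : ℝ) ≤ N')
    (hN'' : ∀ x ∈ Y, ∀ y ∈ Y, ¬ cl x y → ((Y.filter fun z => r x z ∧ r y z).card : ℝ) ≤ N'')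
    (hp' : μ / N * N' ≤ γ) (hp'' : μ / N * N'' ≤ e * μ / 2)
    (htail : Real.exp (-(γ ^ 2 / 4 * μ)) + N ^ 2 * Real.exp (-(e * μ / 8)) ≤ γ * (μ / N)) :
    ∃ X ⊆ Y, ClosedNbhdBound r X ((1 + γ) * μ) (e * ((1 + γ) * μ)) ∧
      Y.card * ((1 - 2 * γ) * (μ / N)) ≤ X.card := by
  have hN0 : 0 < N := hμ.trans_le hμN
  set p : ℝ := μ / N with hp
  have hp0 : 0 ≤ p := by positivity
  have hp1 : p ≤ 1 := (div_le_one hN0).2 hμN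
  have hpN : p * N = μ := by rw [hp]; field_simp
  set nb : V → Finset V := fun x => Y.filter (r x) with hnb
  set cn : V → V → Finset V := fun x y => Y.filter fun z => r x z ∧ r y z with hcn
  set C : V → Finset V := fun x => Y.filter fun y => y ≠ x ∧ cl x y with hC
  set B : V → Finset V := fun x =>
    Y.filter fun y => y ≠ x ∧ ¬ cl x y ∧ ∃ z ∈ Y, r x z ∧ r y z with hB
  set X : Finset V → Finset V := fun S => Y.filter fun x =>
    x ∈ S ∧ (∀ y ∈ C x, ¬ {x, y} ⊆ S) ∧ ¬ ((1 + γ) * μ < ((nb x ∩ S).card : ℝ)) ∧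
      ∀ y ∈ B x, ¬ ((1 + 1) * (e * μ / 2) < ((cn x y ∩ S).card : ℝ)) with hX
  have hBcard : ∀ x ∈ Y, ((B x).card : ℝ) ≤ N ^ 2 := by
    intro x hx
    have h1 : B x ⊆ (nb x).biUnion nb := by
      intro y hy
      simp only [hB, hnb, Finset.mem_filter, Finset.mem_biUnion] at hy ⊢
      obtain ⟨hy, -, -, z, hz, hxz, hyz⟩ := hy
      exact ⟨z, ⟨hz, hxz⟩, hy, hsymm _ _ hyz⟩
    have h2 : ((B x).card : ℝ) ≤ ∑ z ∈ nb x, ((nb z).card : ℝ) := by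
      exact_mod_cast (Finset.card_le_card h1).trans Finset.card_biUnion_le
    refine h2.trans ((Finset.sum_le_card_nsmul _ _ N
      fun z hz => hN z (Finset.mem_filter.1 hz).1).trans ?_)
    rw [nsmul_eq_mul, sq]
    exact mul_le_mul_of_nonneg_right (hN x hx) hN0.le
  have e1 : ∀ x ∈ Y, (1 - 2 * γ) * p ≤ subsetExp p Y (fun S => if x ∈ X S then 1 else 0) := by
    intro x hx
    have e2 : subsetExp p Y (fun S => (((if {x} ⊆ S then (1 : ℝ) else 0) -
        ∑ y ∈ C x, if {x, y} ⊆ S then 1 else 0) -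
        (if (1 + γ) * μ < ((nb x ∩ S).card : ℝ) then 1 else 0)) -
        ∑ y ∈ B x, if (1 + 1) * (e * μ / 2) < ((cn x y ∩ S).card : ℝ) then 1 else 0) ≤
        subsetExp p Y (fun S => if x ∈ X S then 1 else 0) := by
      refine subsetExp_mono hp0 hp1 fun S hS => ?_
      have e3 : ∀ y ∈ B x, (0 : ℝ) ≤
          if (1 + 1) * (e * μ / 2) < ((cn x y ∩ S).card : ℝ) then 1 else 0 := by
        intro y _; split_ifs <;> norm_num
      have e3' : ∀ y ∈ C x, (0 : ℝ) ≤ if {x, y} ⊆ S then 1 else 0 := by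
        intro y _; split_ifs <;> norm_num
      have e4 := Finset.sum_nonneg e3
      have e4' := Finset.sum_nonneg e3'
      have e5 : (0 : ℝ) ≤ if x ∈ X S then 1 else 0 := by split_ifs <;> norm_num
      have e6 : (0 : ℝ) ≤ if (1 + γ) * μ < ((nb x ∩ S).card : ℝ) then 1 else 0 := by
        split_ifs <;> norm_num
      by_cases h1 : {x} ⊆ S
      · rw [if_pos h1]
        by_cases h2 : (1 + γ) * μ < ((nb x ∩ S).card : ℝ)
        · rw [if_pos h2]
          linarith
        by_cases h3 : ∀ y ∈ B x, ¬ ((1 + 1) * (e * μ / 2) < ((cn x y ∩ S).card : ℝ))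
        · by_cases h4 : ∀ y ∈ C x, ¬ {x, y} ⊆ S
          · have : x ∈ X S :=
              Finset.mem_filter.2 ⟨hx, Finset.singleton_subset_iff.1 h1, h4, h2, h3⟩
            rw [if_pos this]
            linarith
          · push Not at h4
            obtain ⟨y, hy, h4⟩ := h4
            have e7 := Finset.single_le_sum e3' hy
            rw [if_pos h4] at e7
            linarith
        · push Not at h3
          obtain ⟨y, hy, h3⟩ := h3
          have e7 := Finset.single_le_sum e3 hy
          rw [if_pos h3] at e7
          linarith
      · rw [if_neg h1]
        linarith
    rw [subsetExp_sub, subsetExp_sub, subsetExp_sub, subsetExp_sum, subsetExp_sum,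
      subsetExp_subset _ (Finset.singleton_subset_iff.2 hx), Finset.card_singleton, pow_one] at e2
    have e3 : ∑ y ∈ C x, subsetExp p Y (fun S => if {x, y} ⊆ S then 1 else 0) ≤ γ * p := by
      have h1 : ∀ y ∈ C x, subsetExp p Y (fun S => if {x, y} ⊆ S then 1 else 0) ≤ p ^ 2 := by
        intro y hy
        simp only [hC, Finset.mem_filter] at hy
        rw [subsetExp_subset _ (by
          intro z hz
          rcases Finset.mem_insert.1 hz with rfl | hz
          · exact hx
          · rw [Finset.mem_singleton.1 hz]; exact hy.1), Finset.card_pair hy.2.1.symm]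
      refine (Finset.sum_le_card_nsmul _ _ _ h1).trans ?_
      have h2 : ((C x).card : ℝ) ≤ N' := by
        refine le_trans ?_ (hN' x hx)
        exact_mod_cast Finset.card_le_card
          (Finset.monotone_filter_right Y fun y _ (hy : y ≠ x ∧ cl x y) => hy.2)
      rw [nsmul_eq_mul]
      have h3 := mul_le_mul_of_nonneg_right h2 (sq_nonneg p)
      have h4 := mul_le_mul_of_nonneg_right hp' hp0
      nlinarith
    have e4 := subsetExp_card_inter_tail (W := Y) (μ := μ) hp0 hp1 (nb x) hγ.le hγ1
      (by rw [← hpN]; exact mul_le_mul_of_nonneg_left (hN x hx) hp0)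
    have e5 : ∀ y ∈ B x, subsetExp p Y
        (fun S => if (1 + 1) * (e * μ / 2) < ((cn x y ∩ S).card : ℝ) then 1 else 0) ≤
        Real.exp (-(e * μ / 8)) := by
      intro y hy
      simp only [hB, Finset.mem_filter] at hy
      refine (subsetExp_card_inter_tail hp0 hp1 (cn x y) zero_le_one le_rfl
        ((mul_le_mul_of_nonneg_left (hN'' x hx y hy.1 hy.2.2.1) hp0).trans hp'')).trans ?_
      rw [Real.exp_le_exp]
      linarith
    have e6 := Finset.sum_le_card_nsmul _ _ _ e5
    rw [nsmul_eq_mul] at e6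
    have e7 := mul_le_mul_of_nonneg_right (hBcard x hx) (Real.exp_pos (-(e * μ / 8))).le
    linarith
  have e8 : (fun S => ((X S).card : ℝ)) = fun S => ∑ v ∈ Y, if v ∈ X S then (1 : ℝ) else 0 := by
    funext S
    rw [Finset.sum_boole, Finset.filter_mem_eq_inter,
      Finset.inter_eq_right.2 (Finset.filter_subset _ _)]
  have e9 : Y.card * ((1 - 2 * γ) * p) ≤ subsetExp p Y (fun S => ((X S).card : ℝ)) := by
    rw [e8, subsetExp_sum, ← nsmul_eq_mul]
    exact Finset.card_nsmul_le_sum _ _ _ e1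
  obtain ⟨S, -, hS⟩ := exists_le_of_le_subsetExp hp0 hp1 e9
  refine ⟨X S, Finset.filter_subset _ _, ⟨?_, ?_⟩, hS⟩
  · intro x hx
    simp only [hX, Finset.mem_filter] at hx
    refine le_trans ?_ (not_lt.1 hx.2.2.2.1)
    have : (X S).filter (r x) ⊆ nb x ∩ S := by
      intro z hz
      simp only [hX, hnb, Finset.mem_filter, Finset.mem_inter] at hz ⊢
      tauto
    exact_mod_cast Finset.card_le_card this
  · intro x hx y hy hxy
    have hy' := Finset.mem_filter.1 hy
    simp only [hX, Finset.mem_filter] at hx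
    have hcl : ¬ cl x y := by
      intro h
      refine hx.2.2.1 y (Finset.mem_filter.2 ⟨hy'.1, hxy.symm, h⟩) ?_
      intro z hz
      rcases Finset.mem_insert.1 hz with rfl | hz
      · exact hx.2.1
      · rw [Finset.mem_singleton.1 hz]; exact hy'.2.1
    have heμ : 0 ≤ e * μ := by positivity
    by_cases hyB : y ∈ B x
    · refine le_trans ?_ ((not_lt.1 (hx.2.2.2.2 y hyB)).trans (by nlinarith))
      have : ((X S).filter fun z => r x z ∧ r y z) ⊆ cn x y ∩ S := by
        intro z hz
        simp only [hX, hcn, Finset.mem_filter, Finset.mem_inter] at hz ⊢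
        tauto
      exact_mod_cast Finset.card_le_card this
    · have : ((X S).filter fun z => r x z ∧ r y z) = ∅ := by
        refine Finset.filter_eq_empty_iff.2 fun z hz h => hyB ?_
        exact Finset.mem_filter.2 ⟨hy'.1, hxy.symm, hcl, z, (Finset.mem_filter.1 hz).1, h⟩
      rw [this]
      simp only [Finset.card_empty, Nat.cast_zero]
      positivity

end Sparsification

section Grid

variable {d : ℕ}

lemma volume_preimage_pi_Ico (x y : Fin d → ℝ) :
    volume ((WithLp.ofLp : EuclideanSpace ℝ (Fin d) → Fin d → ℝ) ⁻¹'
      Set.pi Set.univ fun j => Set.Ico (x j) (y j)) = ∏ j, ENNReal.ofReal (y j - x j) := by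
  rw [(PiLp.volume_preserving_ofLp (Fin d)).measure_preimage
    (MeasurableSet.univ_pi fun _ => measurableSet_Ico).nullMeasurableSet, Real.volume_pi_Ico]

lemma measurableSet_preimage_pi_Ico (x y : Fin d → ℝ) :
    MeasurableSet ((WithLp.ofLp : EuclideanSpace ℝ (Fin d) → Fin d → ℝ) ⁻¹'
      Set.pi Set.univ fun j => Set.Ico (x j) (y j)) :=
  (PiLp.volume_preserving_ofLp (Fin d)).measurable
    (MeasurableSet.univ_pi fun _ => measurableSet_Ico)

lemma dist_le_mul_sqrt {x y : EuclideanSpace ℝ (Fin d)} {δ : ℝ} (hδ : 0 ≤ δ)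
    (h : ∀ j, |x j - y j| ≤ δ) : dist x y ≤ δ * √d := by
  rw [EuclideanSpace.dist_eq]
  apply Real.sqrt_le_iff.mpr ⟨by positivity, ?_⟩
  rw [mul_pow, Real.sq_sqrt (Nat.cast_nonneg d)]
  calc ∑ j, dist (x j) (y j) ^ 2 ≤ ∑ _j : Fin d, δ ^ 2 :=
        Finset.sum_le_sum fun j _ => pow_le_pow_left₀ dist_nonneg (h j) 2
    _ = δ ^ 2 * d := by simp [mul_comm]

/-- Points of a grid of mesh `δ` inside a ball, counted by comparing volumes. -/
lemma card_mul_pow_le_of_subset_ball {δ R : ℝ} (hδ : 0 < δ) (hR : 0 < R)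
    {T : Finset (EuclideanSpace ℝ (Fin d))} (hgrid : ∀ x ∈ T, ∀ j, ∃ i : ℕ, x j = δ * i)
    (c : EuclideanSpace ℝ (Fin d)) (hc : ∀ x ∈ T, dist c x < R) :
    T.card * δ ^ d ≤ (volume (Metric.ball (0 : EuclideanSpace ℝ (Fin d)) 1)).toReal *
      (R + δ * √d) ^ d := by
  set cell : EuclideanSpace ℝ (Fin d) → Set (EuclideanSpace ℝ (Fin d)) := fun x =>
    (WithLp.ofLp : EuclideanSpace ℝ (Fin d) → Fin d → ℝ) ⁻¹'
      Set.pi Set.univ fun j => Set.Ico (x j) (x j + δ) with hcell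
  have hdisj : (T : Set (EuclideanSpace ℝ (Fin d))).PairwiseDisjoint cell := by
    intro x hx y hy hxy
    refine Set.disjoint_left.mpr fun z hzx hzy => hxy ?_
    ext j
    obtain ⟨a, ha⟩ := hgrid x hx j
    obtain ⟨b, hb⟩ := hgrid y hy j
    have h1 := hzx j (Set.mem_univ j)
    have h2 := hzy j (Set.mem_univ j)
    simp only [Set.mem_Ico] at h1 h2
    have hab : (a : ℝ) < b + 1 := by
      refine lt_of_mul_lt_mul_left (a := δ) ?_ hδ.le
      linarith [h1.1, h2.2]
    have hba : (b : ℝ) < a + 1 := by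
      refine lt_of_mul_lt_mul_left (a := δ) ?_ hδ.le
      linarith [h2.1, h1.2]
    have : a = b := by
      have h3 : a < b + 1 := by exact_mod_cast hab
      have h4 : b < a + 1 := by exact_mod_cast hba
      omega
    rw [ha, hb, this]
  have hsub : (⋃ x ∈ T, cell x) ⊆ Metric.ball c (R + δ * √d) := by
    refine Set.iUnion₂_subset fun x hx z hz => ?_
    have h1 : dist z x ≤ δ * √d := dist_le_mul_sqrt hδ.le fun j => by
      have := hz j (Set.mem_univ j)
      simp only [Set.mem_Ico] at this
      rw [abs_of_nonneg (by linarith [this.1])]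
      linarith [this.2]
    rw [Metric.mem_ball]
    have h2 := hc x hx
    rw [dist_comm] at h2
    linarith [dist_triangle z x c]
  have hvol := measure_mono (μ := volume) hsub
  rw [measure_biUnion_finset hdisj fun x _ => measurableSet_preimage_pi_Ico _ _] at hvol
  simp only [hcell, volume_preimage_pi_Ico, add_sub_cancel_left, Finset.prod_const,
    Finset.card_univ, Fintype.card_fin, Finset.sum_const, nsmul_eq_mul] at hvol
  have hpos : 0 < R + δ * √d := by positivity
  rw [Measure.addHaar_ball_of_pos _ _ hpos, finrank_euclideanSpace_fin] at hvol
  have hreal := ENNReal.toReal_mono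
    (ENNReal.mul_ne_top ENNReal.ofReal_ne_top measure_ball_lt_top.ne) hvol
  rw [ENNReal.toReal_mul, ENNReal.toReal_mul, ENNReal.toReal_pow, ENNReal.toReal_ofReal hδ.le,
    ENNReal.toReal_natCast, ENNReal.toReal_ofReal (by positivity), mul_comm (_ ^ d)] at hreal
  exact hreal

lemma volume_ball_le_two_pow :
    (volume (Metric.ball (0 : EuclideanSpace ℝ (Fin d)) 1)).toReal ≤ 2 ^ d := by
  have hsub : Metric.ball (0 : EuclideanSpace ℝ (Fin d)) 1 ⊆
      (WithLp.ofLp : EuclideanSpace ℝ (Fin d) → Fin d → ℝ) ⁻¹'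
        Set.pi Set.univ fun _ => Set.Ico (-1 : ℝ) 1 := by
    intro x hx j _
    have h1 := PiLp.norm_apply_le x j
    rw [mem_ball_zero_iff] at hx
    have := abs_lt.mp (h1.trans_lt hx)
    exact ⟨this.1.le, this.2⟩
  have hvol := measure_mono (μ := volume) hsub
  rw [volume_preimage_pi_Ico (fun _ => -1) (fun _ => 1)] at hvol
  have hreal := ENNReal.toReal_mono (by simp) hvol
  norm_num at hreal
  exact hreal

lemma two_div_sqrt_pow_le_volume_ball (hd : 1 ≤ d) :
    (2 / √d) ^ d ≤ (volume (Metric.ball (0 : EuclideanSpace ℝ (Fin d)) 1)).toReal := by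
  have hd0 : (0 : ℝ) < d := by exact_mod_cast hd
  have hs : (0 : ℝ) < √d := Real.sqrt_pos.mpr hd0
  have hpre : (WithLp.ofLp : EuclideanSpace ℝ (Fin d) → Fin d → ℝ) ⁻¹'
      (Set.pi Set.univ fun _ => Set.Ioo (-(1 / √d)) (1 / √d)) ⊆
      Metric.ball (0 : EuclideanSpace ℝ (Fin d)) 1 := by
    intro x hx
    rw [mem_ball_zero_iff, EuclideanSpace.norm_eq, Real.sqrt_lt' one_pos]
    have : Nonempty (Fin d) := ⟨⟨0, hd⟩⟩
    calc ∑ j, ‖x j‖ ^ 2 < ∑ _j : Fin d, (1 / √d) ^ 2 :=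
          Finset.sum_lt_sum_of_nonempty Finset.univ_nonempty fun j _ =>
            pow_lt_pow_left₀ (abs_lt.mpr (hx j (Set.mem_univ j))) (abs_nonneg _) two_ne_zero
      _ = 1 ^ 2 := by
        rw [Finset.sum_const, Finset.card_univ, Fintype.card_fin, nsmul_eq_mul, div_pow,
          Real.sq_sqrt hd0.le]
        field_simp
  have hvol := measure_mono (μ := volume) hpre
  rw [(PiLp.volume_preserving_ofLp (Fin d)).measure_preimage
    (MeasurableSet.univ_pi fun _ => measurableSet_Ioo).nullMeasurableSet,
    Real.volume_pi_Ioo] at hvol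
  have hreal := ENNReal.toReal_mono measure_ball_lt_top.ne hvol
  rw [Finset.prod_const, Finset.card_univ, Fintype.card_fin, ENNReal.toReal_pow,
    ENNReal.toReal_ofReal (by have : 0 < 1 / √d := by positivity
                              linarith)] at hreal
  convert hreal using 2
  ring

/-- The intersection of two balls of radius `2` lies in a smaller ball about the midpoint of their
centers. -/
lemma dist_midpoint_lt_of_dist_lt_two {x y z : EuclideanSpace ℝ (Fin d)} {r s : ℝ} (hr : 0 ≤ r)
    (hs : 0 ≤ s) (hrs : 4 - r ^ 2 / 4 ≤ s ^ 2) (hxy : r ≤ dist x y) (hx : dist x z < 2)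
    (hy : dist y z < 2) : dist (midpoint ℝ x y) z < s := by
  have h := EuclideanGeometry.dist_sq_add_dist_sq_eq_two_mul_dist_midpoint_sq_add_half_dist_sq z x y
  rw [dist_comm z x, dist_comm z y, dist_comm z] at h
  refine lt_of_pow_lt_pow_left₀ 2 hs ?_
  have h1 : dist x z ^ 2 < 2 ^ 2 := pow_lt_pow_left₀ hx dist_nonneg two_ne_zero
  have h2 : dist y z ^ 2 < 2 ^ 2 := pow_lt_pow_left₀ hy dist_nonneg two_ne_zero
  have h3 : r ^ 2 ≤ dist x y ^ 2 := pow_le_pow_left₀ hr hxy 2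
  nlinarith

/-- The cube `[0, L]^d` contains at least `(L / δ)^d` points of the grid of mesh `δ`. -/
lemma exists_grid {δ L : ℝ} (hδ : 0 < δ) (hL : 0 ≤ L) :
    ∃ Y : Finset (EuclideanSpace ℝ (Fin d)), (∀ x ∈ Y, ∀ j, ∃ i : ℕ, x j = δ * i) ∧
      (∀ x ∈ Y, ∀ j, x j ∈ Set.Icc 0 L) ∧ (L / δ) ^ d ≤ Y.card := by
  classical
  refine ⟨(Fintype.piFinset fun _ : Fin d => Finset.range (⌊L / δ⌋₊ + 1)).image
    fun i => WithLp.toLp 2 fun j => δ * (i j : ℝ), ?_, ?_, ?_⟩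
  · intro x hx j
    obtain ⟨i, -, rfl⟩ := Finset.mem_image.mp hx
    exact ⟨i j, rfl⟩
  · intro x hx j
    obtain ⟨i, hi, rfl⟩ := Finset.mem_image.mp hx
    have hij := Nat.lt_succ_iff.mp (Finset.mem_range.mp (Fintype.mem_piFinset.mp hi j))
    have h1 : (i j : ℝ) ≤ L / δ := (Nat.le_floor_iff (by positivity)).mp hij
    rw [le_div_iff₀ hδ] at h1
    exact ⟨by positivity, by simpa [mul_comm] using h1⟩
  · rw [Finset.card_image_of_injective]
    · rw [Fintype.card_piFinset]
      simp only [Finset.card_range, Finset.prod_const, Finset.card_univ, Fintype.card_fin]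
      push_cast
      exact pow_le_pow_left₀ (by positivity) (Nat.lt_floor_add_one _).le d
    · intro i i' h
      ext j
      have := congrArg (fun v : EuclideanSpace ℝ (Fin d) => v j) h
      simpa [hδ.ne'] using this

end Grid

section Packing

variable {d : ℕ}

lemma exists_packing {γ μ e δ r s L V N : ℝ} (hγ : 0 < γ) (hγ1 : γ ≤ 1 / 2) (hμ : 0 < μ)
    (he : 0 < e) (he1 : e ≤ 1) (hδ : 0 < δ) (hr : 0 < r) (hs : 0 < s) (hL : 0 ≤ L)
    (hV : V = (volume (Metric.ball (0 : EuclideanSpace ℝ (Fin d)) 1)).toReal) (hV0 : 0 < V)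
    (hN : N = V * ((2 + δ * √d) / δ) ^ d) (hμN : μ ≤ N) (hrs : 4 - r ^ 2 / 4 ≤ s ^ 2)
    (hclose : μ * ((r + δ * √d) / (2 + δ * √d)) ^ d ≤ γ)
    (hlens : ((s + δ * √d) / (2 + δ * √d)) ^ d ≤ e / 2)
    (htail : Real.exp (-(γ ^ 2 / 4 * μ)) + N ^ 2 * Real.exp (-(e * μ / 8)) ≤ γ * (μ / N))
    (hlog : 2 ≤ Real.log ((1 + γ) * μ))
    (hloge : 64 * Real.log ((1 + γ) * μ) ^ 3 * e ≤ γ ^ 3)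
    (hlogγ : 4 * Real.log ((1 + γ) * μ) ≤ γ ^ 2 * ((1 + γ) * μ) ^ 2)
    (hmain : 0 ≤ Real.log μ + 2 * Real.log e) :
    ∃ S : Finset (EuclideanSpace ℝ (Fin d)), (∀ x ∈ S, ∀ i, x i ∈ Set.Icc (0 : ℝ) L) ∧
      (∀ x ∈ S, ∀ y ∈ S, x ≠ y → 2 ≤ dist x y) ∧
      (1 - γ) ^ 3 * ((1 - 2 * γ) / (1 + γ)) * (L / (2 + δ * √d)) ^ d *
        (Real.log μ + 2 * Real.log e) ≤ S.card * V := by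
  classical
  obtain ⟨Y, hgrid, hbox, hcard⟩ := exists_grid (d := d) hδ hL
  have hh : 0 ≤ δ * √d := by positivity
  have hball : ∀ R : ℝ, 0 < R → ∀ c : EuclideanSpace ℝ (Fin d), ∀ T ⊆ Y,
      (∀ x ∈ T, dist c x < R) → (T.card : ℝ) ≤ V * ((R + δ * √d) / δ) ^ d := by
    intro R hR c T hTY hT
    have h := card_mul_pow_le_of_subset_ball hδ hR (fun x hx => hgrid x (hTY hx)) c hT
    rw [← hV] at h
    rw [div_pow, ← mul_div_assoc, le_div_iff₀ (by positivity)]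
    exact h
  have hratio : ∀ R : ℝ, μ / N * (V * ((R + δ * √d) / δ) ^ d) =
      μ * ((R + δ * √d) / (2 + δ * √d)) ^ d := by
    intro R
    have h2 : 0 < 2 + δ * √d := by positivity
    rw [hN]
    simp only [div_pow]
    field_simp
  have hNpos : 0 < N := hμ.trans_le hμN
  obtain ⟨X, hXY, hX, hXcard⟩ := exists_sparse_closedNbhdBound
    (r := fun x y : EuclideanSpace ℝ (Fin d) => dist x y < 2) (cl := fun x y => dist x y < r)
    (fun v w h => by rwa [dist_comm]) (Y := Y) (N := N) (N' := V * ((r + δ * √d) / δ) ^ d)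
    (N'' := V * ((s + δ * √d) / δ) ^ d) hγ (by linarith) hμ hμN he
    (fun x _ => hN ▸ hball 2 two_pos x _ (Finset.filter_subset _ _) fun z hz =>
      (Finset.mem_filter.mp hz).2)
    (fun x _ => hball r hr x _ (Finset.filter_subset _ _) fun z hz => (Finset.mem_filter.mp hz).2)
    (fun x _ y _ hxy => hball s hs (midpoint ℝ x y) _ (Finset.filter_subset _ _) fun z hz =>
      dist_midpoint_lt_of_dist_lt_two hr.le hs.le hrs (not_lt.mp hxy)
        (Finset.mem_filter.mp hz).2.1 (Finset.mem_filter.mp hz).2.2)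
    ((hratio r).trans_le hclose)
    ((hratio s).trans_le ((mul_le_mul_of_nonneg_left hlens hμ.le).trans_eq (by ring))) htail
  have hDpos : 0 < (1 + γ) * μ := by positivity
  obtain ⟨I, hIX, hI, hIcard⟩ := exists_indep_of_closedNbhdBound
    (r := fun x y : EuclideanSpace ℝ (Fin d) => dist x y < 2) (fun v => by simp)
    (fun v w h => by rwa [dist_comm]) hγ hγ1 he he1 hDpos hlog hloge hlogγ hX
  refine ⟨I, fun x hx => hbox x (hXY (hIX hx)), fun x hx y hy hxy => not_lt.mp (hI x hx y hy hxy),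
    (mul_le_mul_of_nonneg_right ?_ hV0.le).trans' ?_ (b := ((1 - γ) ^ 3 *
      ((L / δ) ^ d * ((1 - 2 * γ) * (μ / N)) / ((1 + γ) * μ)) *
      (Real.log μ + 2 * Real.log e)) * V)⟩
  · refine hIcard.trans' ?_
    have hlogle : Real.log μ ≤ Real.log ((1 + γ) * μ) :=
      Real.log_le_log hμ (by nlinarith)
    have hXc : (L / δ) ^ d * ((1 - 2 * γ) * (μ / N)) ≤ X.card :=
      hXcard.trans' (mul_le_mul_of_nonneg_right hcard
        (mul_nonneg (by linarith) (by positivity)))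
    have h1γ : 0 ≤ 1 - γ := by linarith
    gcongr
  · refine le_of_eq ?_
    have h2 : 0 < 2 + δ * √d := by positivity
    rw [hN]
    simp only [div_pow]
    field_simp

end Packing

section Asymptotics

lemma pow_le_exp_mul_log {x t : ℝ} (hx : 1 ≤ x) {k : ℕ} (hk : k ≤ t) :
    x ^ k ≤ Real.exp (t * Real.log x) := by
  rw [← Real.exp_log (pow_pos (by linarith : 0 < x) k), Real.log_pow]
  exact Real.exp_le_exp.mpr (mul_le_mul_of_nonneg_right hk (Real.log_nonneg hx))

lemma tail_bound {γ x b N : ℝ} (hγ : 0 < γ) (hγ1 : γ ≤ 1) (hx : 128 ≤ x) (hγx : 64 ≤ γ ^ 3 * x)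
    (hb : 1 / 4 ≤ b) (hN0 : 0 < N) (hN : N ≤ Real.exp (4 * (x * Real.log x))) :
    Real.exp (-(γ ^ 2 / 4 * Real.exp (b * (x * Real.log x)))) +
      N ^ 2 * Real.exp (-((x ^ 8)⁻¹ * Real.exp (b * (x * Real.log x)) / 8)) ≤
      γ * (Real.exp (b * (x * Real.log x)) / N) := by
  set l := Real.log x with hl
  have hx0 : 0 < x := by linarith
  have hl0 : 0 ≤ l := Real.log_nonneg (by linarith)
  have hlx : l ≤ x := (Real.log_le_sub_one_of_pos hx0).trans (by linarith)
  have hl1 : 1 ≤ l := by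
    rw [hl, Real.le_log_iff_exp_le hx0]
    linarith [Real.exp_one_lt_d9]
  set μ := Real.exp (b * (x * l)) with hμ
  have hμ1 : 1 ≤ μ := Real.one_le_exp (by positivity)
  have hμ12 : x ^ 12 ≤ μ := by
    rw [hμ, ← mul_assoc]
    exact pow_le_exp_mul_log (by linarith) (by push_cast; nlinarith)
  have hγ2x : 1 ≤ γ ^ 2 * x := by
    have : γ ^ 3 * x ≤ γ ^ 2 * x :=
      mul_le_mul_of_nonneg_right (pow_le_pow_of_le_one hγ.le hγ1 (by norm_num)) hx0.le
    linarith
  have hγx' : 2 ≤ γ * x := by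
    have : γ ^ 3 * x ≤ γ ^ 1 * x :=
      mul_le_mul_of_nonneg_right (pow_le_pow_of_le_one hγ.le hγ1 (by norm_num)) hx0.le
    linarith
  have heμ : 13 * (x * l) ≤ (x ^ 8)⁻¹ * μ / 8 := by
    have h1 : x ^ 4 ≤ (x ^ 8)⁻¹ * μ := by
      rw [inv_mul_eq_div, le_div_iff₀ (by positivity)]
      linarith [show x ^ 4 * x ^ 8 = x ^ 12 by ring]
    have h2 : x * l ≤ x ^ 2 := by nlinarith
    have h3 : 128 ^ 2 * x ^ 2 ≤ x ^ 4 := by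
      have : 128 ^ 2 ≤ x ^ 2 := pow_le_pow_left₀ (by norm_num) hx 2
      nlinarith [sq_nonneg x]
    nlinarith [sq_nonneg x]
  have he8 : (x ^ 8)⁻¹ * μ / 8 ≤ γ ^ 2 / 4 * μ := by
    have h1 : (x ^ 8)⁻¹ ≤ γ ^ 2 := by
      rw [inv_le_iff_one_le_mul₀ (by positivity)]
      have : x ^ 1 ≤ x ^ 8 := pow_le_pow_right₀ (by linarith) (by norm_num)
      nlinarith [sq_nonneg γ]
    nlinarith
  have hlogγ : Real.exp (-(x * l)) ≤ γ / 2 := by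
    have h1 : Real.exp (-l) = x⁻¹ := by rw [Real.exp_neg, hl, Real.exp_log hx0]
    have h2 : Real.exp (-(x * l)) ≤ Real.exp (-l) := Real.exp_le_exp.mpr (by nlinarith)
    refine h2.trans ?_
    rw [h1, inv_le_iff_one_le_mul₀ hx0]
    linarith
  have hA : Real.exp (-((x ^ 8)⁻¹ * μ / 8)) ≤ γ / 2 * Real.exp (-(12 * (x * l))) := by
    calc Real.exp (-((x ^ 8)⁻¹ * μ / 8)) ≤ Real.exp (-(x * l) + -(12 * (x * l))) :=
          Real.exp_le_exp.mpr (by linarith)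
      _ = Real.exp (-(x * l)) * Real.exp (-(12 * (x * l))) := Real.exp_add _ _
      _ ≤ _ := by gcongr
  have hE : Real.exp (-(12 * (x * l))) * Real.exp (4 * (x * l)) ^ 3 = 1 := by
    rw [← Real.exp_nat_mul, ← Real.exp_add]
    simp only [Nat.cast_ofNat]
    rw [show -(12 * (x * l)) + 3 * (4 * (x * l)) = 0 by ring, Real.exp_zero]
  have hE1 : 1 ≤ Real.exp (4 * (x * l)) := Real.one_le_exp (by positivity)
  rw [← mul_div_assoc, le_div_iff₀ hN0]
  set E := Real.exp (4 * (x * l))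
  set T := Real.exp (-((x ^ 8)⁻¹ * μ / 8))
  have hT1 : Real.exp (-(γ ^ 2 / 4 * μ)) ≤ T := Real.exp_le_exp.mpr (by linarith)
  have hT0 : 0 < T := Real.exp_pos _
  have hTE : T * E ^ 3 ≤ γ / 2 := by
    calc T * E ^ 3 ≤ γ / 2 * Real.exp (-(12 * (x * l))) * E ^ 3 := by gcongr
      _ = γ / 2 := by rw [mul_assoc, hE, mul_one]
  have hN1 : T * N ≤ γ / 2 := by
    refine le_trans ?_ hTE
    have : E ^ 1 ≤ E ^ 3 := pow_le_pow_right₀ hE1 (by norm_num)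
    gcongr
    linarith
  have hN3 : T * N ^ 3 ≤ γ / 2 := le_trans (by gcongr) hTE
  calc (Real.exp (-(γ ^ 2 / 4 * μ)) + N ^ 2 * T) * N ≤ (T + N ^ 2 * T) * N := by gcongr
    _ = T * N + T * N ^ 3 := by ring
    _ ≤ γ * 1 := by linarith
    _ ≤ γ * μ := by gcongr

lemma log_bounds {γ x b : ℝ} (hγ : 0 < γ) (hγ1 : γ ≤ 1) (hx : 128 ≤ x) (hγx : 64 ≤ γ ^ 3 * x)
    (hb : 1 / 4 ≤ b) (hb1 : b ≤ 1 / 2) :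
    2 ≤ Real.log ((1 + γ) * Real.exp (b * (x * Real.log x))) ∧
    64 * Real.log ((1 + γ) * Real.exp (b * (x * Real.log x))) ^ 3 * (x ^ 8)⁻¹ ≤ γ ^ 3 ∧
    4 * Real.log ((1 + γ) * Real.exp (b * (x * Real.log x))) ≤
      γ ^ 2 * ((1 + γ) * Real.exp (b * (x * Real.log x))) ^ 2 := by
  set l := Real.log x with hl
  have hx0 : 0 < x := by linarith
  have hlx : l ≤ x := (Real.log_le_sub_one_of_pos hx0).trans (by linarith)
  have hl1 : 1 ≤ l := by
    rw [hl, Real.le_log_iff_exp_le hx0]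
    linarith [Real.exp_one_lt_d9]
  have hxl : 128 ≤ x * l := by nlinarith
  have hxl2 : x * l ≤ x ^ 2 := by nlinarith
  have hγ2x : 4 ≤ γ ^ 2 * x := by
    have : γ ^ 3 * x ≤ γ ^ 2 * x :=
      mul_le_mul_of_nonneg_right (pow_le_pow_of_le_one hγ.le hγ1 (by norm_num)) hx0.le
    linarith
  have hlog : Real.log ((1 + γ) * Real.exp (b * (x * l))) = Real.log (1 + γ) + b * (x * l) := by
    rw [Real.log_mul (by linarith) (Real.exp_pos _).ne', Real.log_exp]
  have hg0 : 0 ≤ Real.log (1 + γ) := Real.log_nonneg (by linarith)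
  have hg1 : Real.log (1 + γ) ≤ 1 :=
    (Real.log_le_sub_one_of_pos (by linarith)).trans (by linarith)
  have hlow : 2 ≤ Real.log ((1 + γ) * Real.exp (b * (x * l))) := by
    rw [hlog]
    nlinarith
  have hupp : Real.log ((1 + γ) * Real.exp (b * (x * l))) ≤ x ^ 2 := by
    rw [hlog]
    nlinarith
  have hD : x ≤ (1 + γ) * Real.exp (b * (x * l)) := by
    have h1 : x ^ 1 ≤ Real.exp (b * x * l) :=
      pow_le_exp_mul_log (by linarith) (by push_cast; nlinarith)
    rw [pow_one, mul_assoc] at h1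
    nlinarith
  refine ⟨hlow, ?_, ?_⟩
  · rw [← div_eq_mul_inv, div_le_iff₀ (by positivity)]
    have h1 : Real.log ((1 + γ) * Real.exp (b * (x * l))) ^ 3 ≤ (x ^ 2) ^ 3 :=
      pow_le_pow_left₀ (by linarith) hupp 3
    have h2 : 64 * x ^ 7 ≤ γ ^ 3 * x * x ^ 7 := by gcongr
    have h3 : x ^ 6 ≤ x ^ 7 := pow_le_pow_right₀ (by linarith) (by norm_num)
    nlinarith
  · have h1 := Real.log_le_sub_one_of_pos (hx0.trans_le hD)
    set D := (1 + γ) * Real.exp (b * (x * l))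
    have h2 : 4 ≤ γ ^ 2 * D := hγ2x.trans (by gcongr)
    nlinarith

end Asymptotics

section Main

lemma volume_mul_pow_bounds {d : ℕ} (hd : 128 ≤ d) {h V : ℝ} (hh : h = ((d : ℝ) ^ 2)⁻¹)
    (hVlow : (2 / √d) ^ d ≤ V) (hVupp : V ≤ 2 ^ d) :
    Real.exp (d * Real.log d) ≤ V * ((2 + h) / (h / √d)) ^ d ∧
      V * ((2 + h) / (h / √d)) ^ d ≤ Real.exp (4 * (d * Real.log d)) := by
  have hx : (128 : ℝ) ≤ d := by exact_mod_cast hd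
  have hx0 : (0 : ℝ) < d := by linarith
  have hs : 0 < √(d : ℝ) := Real.sqrt_pos.mpr hx0
  have hss : √(d : ℝ) ^ 2 = d := Real.sq_sqrt hx0.le
  have hs1 : √(d : ℝ) ≤ d := by nlinarith
  have hh0 : 0 < h := by rw [hh]; positivity
  have hh1 : h ≤ 1 := by
    rw [hh, inv_le_one₀ (by positivity)]
    nlinarith
  have hV0 : 0 ≤ V := le_trans (by positivity) hVlow
  have hexp : Real.exp (d * Real.log d) = (d : ℝ) ^ d := by
    rw [Real.exp_nat_mul, Real.exp_log hx0]
  have heq : (2 + h) / (h / √d) = (2 + h) * √d * (d : ℝ) ^ 2 := by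
    have : h * (d : ℝ) ^ 2 = 1 := by rw [hh]; field_simp
    rw [div_div_eq_mul_div, div_eq_iff hh0.ne', mul_assoc _ _ h, mul_comm _ h, this, mul_one]
  rw [heq]
  constructor
  · calc Real.exp (d * Real.log d) = (d : ℝ) ^ d := hexp
      _ ≤ (2 / √d * (2 * √d * (d : ℝ) ^ 2)) ^ d := by
        refine pow_le_pow_left₀ hx0.le ?_ d
        rw [show 2 / √(d : ℝ) * (2 * √d * (d : ℝ) ^ 2) = 4 * (d : ℝ) ^ 2 by field_simp; ring]
        nlinarith
      _ = (2 / √d) ^ d * (2 * √d * (d : ℝ) ^ 2) ^ d := mul_pow _ _ _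
      _ ≤ V * ((2 + h) * √d * (d : ℝ) ^ 2) ^ d := by
        gcongr
        linarith
  · calc V * ((2 + h) * √d * (d : ℝ) ^ 2) ^ d ≤ 2 ^ d * (3 * d * (d : ℝ) ^ 2) ^ d := by
          gcongr
          linarith
      _ = (2 * (3 * d * (d : ℝ) ^ 2)) ^ d := (mul_pow _ _ _).symm
      _ ≤ ((d : ℝ) ^ 4) ^ d := by
        refine pow_le_pow_left₀ (by positivity) ?_ d
        rw [show 2 * (3 * (d : ℝ) * (d : ℝ) ^ 2) = 6 * (d : ℝ) ^ 3 by ring,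
          show (d : ℝ) ^ 4 = d * (d : ℝ) ^ 3 by ring]
        gcongr
        linarith
      _ = Real.exp (4 * (d * Real.log d)) := by
        rw [← pow_mul, mul_comm 4 d, pow_mul, ← hexp, ← Real.exp_nat_mul]
        norm_num

lemma scale_le {γ h L : ℝ} {d : ℕ} (hL : 0 ≤ L) (hh0 : 0 ≤ h) (hh1 : h ≤ 1) (hdh : d * h ≤ γ) :
    (1 - γ) * (L ^ d / 2 ^ d) ≤ (L / (2 + h)) ^ d := by
  have h1 : 1 - γ ≤ (1 - h / 2) ^ d := by
    have hB := one_add_mul_le_pow (a := -(h / 2)) (by linarith) d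
    rw [← sub_eq_add_neg] at hB
    have : 0 ≤ d * h := by positivity
    linarith
  calc (1 - γ) * (L ^ d / 2 ^ d) ≤ (1 - h / 2) ^ d * (L ^ d / 2 ^ d) := by gcongr
    _ = ((1 - h / 2) * (L / 2)) ^ d := by rw [mul_pow, div_pow]
    _ ≤ (L / (2 + h)) ^ d := by
      refine pow_le_pow_left₀ (mul_nonneg (by linarith) (by positivity)) ?_ d
      rw [le_div_iff₀ (by positivity)]
      nlinarith [mul_nonneg hL (sq_nonneg h)]

lemma coeff_le {γ : ℝ} (hγ : 0 < γ) (hγ1 : γ ≤ 1 / 8) : (1 - 11 * γ) / 2 ≤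
    (1 - γ) ^ 3 * ((1 - 2 * γ) / (1 + γ)) * (1 - γ) * (1 / 2 - γ - γ) := by
  have h1 : 1 - 3 * γ ≤ (1 - 2 * γ) / (1 + γ) := by
    rw [le_div_iff₀ (by linarith)]
    nlinarith
  have h2 : 1 - 4 * γ ≤ (1 - γ) ^ 4 := by
    have := one_add_mul_le_pow (a := -γ) (by linarith) 4
    push_cast at this
    rw [← sub_eq_add_neg] at this
    linarith
  calc (1 - 11 * γ) / 2 ≤ (1 - 4 * γ) * (1 - 3 * γ) * (1 / 2 - γ - γ) := by
        nlinarith [mul_nonneg (sq_nonneg γ) (by linarith : 0 ≤ 1 - γ)]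
    _ ≤ (1 - γ) ^ 4 * ((1 - 2 * γ) / (1 + γ)) * (1 / 2 - γ - γ) := by
      have : 0 ≤ 1 - 3 * γ := by linarith
      have : 0 ≤ 1 / 2 - γ - γ := by linarith
      gcongr
    _ = _ := by ring

lemma exists_packing_of_large {γ L : ℝ} (hγ : 0 < γ) (hγ1 : γ ≤ 1 / 8) (hL : 0 ≤ L) {d : ℕ}
    (hd : 128 ≤ d) (hγd : 64 ≤ γ ^ 3 * d) (hlogd : 2304 * Real.log d ≤ (d : ℝ) ^ (2 * γ)) :
    ∃ S : Finset (EuclideanSpace ℝ (Fin d)), (∀ x ∈ S, ∀ i, x i ∈ Set.Icc (0 : ℝ) L) ∧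
      (∀ x ∈ S, ∀ y ∈ S, x ≠ y → 2 ≤ dist x y) ∧
      (1 - 11 * γ) * (d * Real.log d / 2 ^ (d + 1)) * L ^ d ≤
        S.card * (volume (Metric.ball (0 : EuclideanSpace ℝ (Fin d)) 1)).toReal := by
  have hx : (128 : ℝ) ≤ d := by exact_mod_cast hd
  have hx0 : (0 : ℝ) < d := by linarith
  set l := Real.log d with hl
  have hl1 : 1 ≤ l := by
    rw [hl, Real.le_log_iff_exp_le hx0]
    linarith [Real.exp_one_lt_d9]
  have hel : Real.exp l = d := Real.exp_log hx0
  set b : ℝ := 1 / 2 - γ with hb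
  set μ := Real.exp (b * (d * l)) with hμ
  set a := Real.exp (-(b * l)) with ha
  have ha0 : 0 < a := Real.exp_pos _
  have ha1 : a ≤ 1 := Real.exp_le_one_iff.mpr
    (neg_nonpos.mpr (mul_nonneg (by linarith) (by linarith)))
  have ha2 : a ^ 2 ≤ 1 := pow_le_one₀ ha0.le ha1
  have haa : a ^ 2 ≤ a := pow_le_of_le_one ha0.le ha1 two_ne_zero
  have hμa : μ * a ^ d = 1 := by
    rw [hμ, ha, ← Real.exp_nat_mul, ← Real.exp_add, show b * (d * l) + d * -(b * l) = 0 by ring,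
      Real.exp_zero]
  have hda : d * a ^ 2 = (d : ℝ) ^ (2 * γ) := by
    rw [Real.rpow_def_of_pos hx0, ← hl, ha, ← Real.exp_nat_mul]
    nth_rewrite 1 [← hel]
    rw [← Real.exp_add]
    congr 1
    push_cast
    rw [hb]
    ring
  have hda1 : 1 ≤ d * a ^ 2 := by linarith
  set h : ℝ := ((d : ℝ) ^ 2)⁻¹ with hh
  have hh0 : 0 < h := by positivity
  have hha : h ≤ a ^ 2 / 128 := by
    rw [hh, inv_le_iff_one_le_mul₀ (by positivity)]
    linarith [mul_le_mul hda1 hx (by norm_num) (by positivity),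
      show a ^ 2 / 128 * (d : ℝ) ^ 2 = d * a ^ 2 * d / 128 by ring]
  have hδ : h / √d * √d = h := div_mul_cancel₀ _ (Real.sqrt_pos.mpr hx0).ne'
  set V := (volume (Metric.ball (0 : EuclideanSpace ℝ (Fin d)) 1)).toReal with hV
  have hVlow : (2 / √d) ^ d ≤ V := two_div_sqrt_pow_le_volume_ball (by omega)
  have hV0 : 0 < V := lt_of_lt_of_le (by positivity) hVlow
  obtain ⟨hNlow, hNupp⟩ := volume_mul_pow_bounds hd hh hVlow volume_ball_le_two_pow
  set N := V * ((2 + h) / (h / √d)) ^ d with hN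
  have hμN : μ ≤ N := hNlow.trans' <| Real.exp_le_exp.mpr <|
    mul_le_of_le_one_left (by positivity) (by linarith)
  have hγd' : 16 ≤ γ * d := by
    have : γ ^ 3 * d ≤ γ ^ 1 * d :=
      mul_le_mul_of_nonneg_right (pow_le_pow_of_le_one hγ.le (by linarith) (by norm_num)) hx0.le
    linarith
  have hclose : μ * ((a / 2 + h) / (2 + h)) ^ d ≤ γ := by
    calc μ * ((a / 2 + h) / (2 + h)) ^ d ≤ μ * (a * (1 / 2)) ^ d := by
          gcongr
          rw [div_le_iff₀ (by positivity)]
          linarith [mul_pos ha0 hh0]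
      _ = (1 / 2) ^ d := by rw [mul_pow, ← mul_assoc, hμa, one_mul]
      _ ≤ γ := by
        rw [one_div, inv_pow, inv_le_iff_one_le_mul₀ (by positivity)]
        have : (d : ℝ) ≤ 2 ^ d := by exact_mod_cast Nat.lt_two_pow_self.le
        calc (1 : ℝ) ≤ γ * d := by linarith
          _ ≤ γ * 2 ^ d := by gcongr
  have hlens : ((2 - a ^ 2 / 64 + h) / (2 + h)) ^ d ≤ ((d : ℝ) ^ 8)⁻¹ / 2 := by
    calc ((2 - a ^ 2 / 64 + h) / (2 + h)) ^ d ≤ Real.exp (-(a ^ 2 / 256)) ^ d := by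
          refine pow_le_pow_left₀ (div_nonneg (by linarith) (by linarith)) ?_ d
          refine le_trans ?_ (Real.one_sub_le_exp_neg _)
          rw [div_le_iff₀ (by positivity)]
          linarith [mul_le_of_le_one_left hh0.le ha2]
      _ = Real.exp (-(d * a ^ 2 / 256)) := by
        rw [← Real.exp_nat_mul]
        congr 1
        ring
      _ ≤ Real.exp (-((9 : ℕ) * l)) := Real.exp_le_exp.mpr (by push_cast; linarith)
      _ = ((d : ℝ) ^ 9)⁻¹ := by rw [Real.exp_neg, Real.exp_nat_mul, hel]
      _ ≤ ((d : ℝ) ^ 8)⁻¹ / 2 := by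
        rw [div_eq_mul_inv, ← mul_inv]
        gcongr
        rw [pow_succ _ 8]
        gcongr
        linarith
  obtain ⟨hlog, hloge, hlogγ⟩ := log_bounds (b := b) hγ (by linarith) hx hγd (by linarith)
    (by linarith)
  have htail := tail_bound (b := b) hγ (by linarith) hx hγd (by linarith)
    (hμN.trans_lt' (Real.exp_pos _)) hNupp
  have hloge8 : Real.log ((d : ℝ) ^ 8)⁻¹ = -(8 * l) := by
    rw [Real.log_inv, Real.log_pow, Nat.cast_ofNat]
  have hmain : (b - γ) * (d * l) ≤ Real.log μ + 2 * Real.log ((d : ℝ) ^ 8)⁻¹ := by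
    rw [hloge8, hμ, Real.log_exp]
    linarith [mul_le_mul_of_nonneg_right hγd' (by linarith : 0 ≤ l)]
  have hbγ : 0 ≤ (b - γ) * (d * l) := mul_nonneg (by linarith) (by positivity)
  rw [← hl, ← hμ] at hlog hloge hlogγ htail
  have hμ0 : 0 < μ := Real.exp_pos _
  clear_value V N μ a h l
  obtain ⟨S, hbox, hsep, hcard⟩ := exists_packing (γ := γ) (μ := μ) (e := ((d : ℝ) ^ 8)⁻¹)
    (δ := h / √d) (r := a / 2) (s := 2 - a ^ 2 / 64) hγ (by linarith) hμ0
    (by positivity) (inv_le_one_of_one_le₀ (one_le_pow₀ (by linarith))) (by positivity)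
    (by positivity) (by linarith) hL hV hV0 (by rw [hδ, hN]) hμN
    (by linarith [sq_nonneg (a ^ 2),
      show (2 - a ^ 2 / 64) ^ 2 = 4 - a ^ 2 / 16 + (a ^ 2) ^ 2 / 4096 by ring])
    (by rwa [hδ]) (by rwa [hδ]) htail hlog hloge hlogγ (hbγ.trans hmain)
  refine ⟨S, hbox, hsep, hcard.trans' ?_⟩
  rw [hδ]
  have hdh : d * h ≤ γ := by
    rw [hh, ← div_eq_mul_inv, div_le_iff₀ (by positivity)]
    calc (d : ℝ) ≤ 16 * d := by linarith
      _ ≤ γ * d * d := by gcongr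
      _ = γ * (d : ℝ) ^ 2 := by ring
  have hscale := scale_le hL hh0.le (by linarith : h ≤ 1) hdh
  have hcoef := coeff_le hγ hγ1
  rw [show 1 / 2 - γ - γ = b - γ by rw [hb]] at hcoef
  have hc : 0 ≤ (1 - γ) ^ 3 * ((1 - 2 * γ) / (1 + γ)) :=
    mul_nonneg (pow_nonneg (by linarith) 3) (div_nonneg (by linarith) (by linarith))
  calc (1 - 11 * γ) * (d * l / 2 ^ (d + 1)) * L ^ d
      = (1 - 11 * γ) / 2 * (d * l * (L ^ d / 2 ^ d)) := by
        rw [pow_succ]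
        field_simp
    _ ≤ (1 - γ) ^ 3 * ((1 - 2 * γ) / (1 + γ)) * (1 - γ) * (b - γ) * (d * l * (L ^ d / 2 ^ d)) := by
        gcongr
    _ = (1 - γ) ^ 3 * ((1 - 2 * γ) / (1 + γ)) * ((1 - γ) * (L ^ d / 2 ^ d)) *
        ((b - γ) * (d * l)) := by ring
    _ ≤ _ := by gcongr

end Main

/-- **Campos–Jenssen–Michelen–Sahasrabudhe sphere packing bound.** For every `ε > 0`,
for all sufficiently large `d`, there exists `L₀ > 0` such that for every `L ≥ L₀` there
is a finite set `S ⊆ [0,L]^d` of points with pairwise distances at least `2` with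
`|S| · Vol(B₁^d) ≥ (1 - ε) (d log d / 2^{d+1}) L^d`.  In particular the sphere packing
density satisfies `θ(d) ≥ (1 - o(1)) d log d / 2^{d+1}`. -/
theorem sphere_packing_CJMS (ε : ℝ) (hε : 0 < ε) :
    ∃ d₀ : ℕ, ∀ d : ℕ, d₀ ≤ d →
      ∃ L₀ : ℝ, 0 < L₀ ∧ ∀ L : ℝ, L₀ ≤ L →
        ∃ S : Finset (EuclideanSpace ℝ (Fin d)),
          (∀ x ∈ S, ∀ i, x i ∈ Set.Icc (0 : ℝ) L) ∧
          (∀ x ∈ S, ∀ y ∈ S, x ≠ y → 2 ≤ dist x y) ∧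
          (1 - ε) * (d * Real.log d / 2 ^ (d + 1)) * L ^ d ≤
            S.card * (volume (Metric.ball (0 : EuclideanSpace ℝ (Fin d)) 1)).toReal := by
  set γ := min (1 / 8) (ε / 11) with hγ
  have hγ0 : 0 < γ := lt_min (by norm_num) (by positivity)
  have hγ8 : γ ≤ 1 / 8 := min_le_left _ _
  have hγε : 11 * γ ≤ ε := by linarith [min_le_right (1 / 8) (ε / 11)]
  have hlog : ∀ᶠ d : ℕ in Filter.atTop, 2304 * Real.log d ≤ (d : ℝ) ^ (2 * γ) := by
    have h := ((isLittleO_log_rpow_atTop (by positivity : 0 < 2 * γ)).def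
      (by norm_num : (0 : ℝ) < 1 / 2304)).natCast_atTop
    filter_upwards [h] with d hd
    rw [Real.norm_of_nonneg (Real.log_natCast_nonneg d), Real.norm_of_nonneg (by positivity)] at hd
    linarith
  have hlarge : ∀ᶠ d : ℕ in Filter.atTop, 64 ≤ γ ^ 3 * d :=
    (tendsto_natCast_atTop_atTop.const_mul_atTop (by positivity)).eventually_ge_atTop 64
  obtain ⟨d₀, hd₀⟩ := Filter.eventually_atTop.mp
    (hlog.and (hlarge.and (Filter.eventually_ge_atTop 128)))
  refine ⟨d₀, fun d hd => ⟨1, one_pos, fun L hL => ?_⟩⟩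
  obtain ⟨h1, h2, h3⟩ := hd₀ d hd
  obtain ⟨S, hbox, hsep, hcard⟩ := exists_packing_of_large hγ0 hγ8 (by linarith : 0 ≤ L) h3 h2 h1
  refine ⟨S, hbox, hsep, hcard.trans' ?_⟩
  have : 0 ≤ Real.log d := Real.log_natCast_nonneg d
  have : 0 ≤ L := by linarith
  gcongr
end
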